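/- arXiv:2402.01519 — 3 statements merged into one kernel-verified Lean document; each statement's English description precedes it below -/
import Mathlib

section
/- Let Ω be an open subset of ℝ^N, and let {z_n} ⊂ ℝ^N and {μ_n} ⊂ (0,+∞) be sequences such that z_n → z₀ with z₀ ∈ −Ω (i.e., −z₀ ∈ Ω) and μ_n → +∞. Then ⋃_{n∈ℕ} μ_n·(z_n + Ω) = ℝ^N. -/
open Filter Topology

theorem stmt_1 {N : ℕ} (hN : 1 ≤ N)
    (Ω : Set (EuclideanSpace ℝ (Fin N))) (hΩ : IsOpen Ω)
    (z : ℕ → EuclideanSpace ℝ (Fin N)) (μ : ℕ → ℝ)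
    (hμpos : ∀ n, 0 < μ n)
    (z₀ : EuclideanSpace ℝ (Fin N))
    (hz : Tendsto z atTop (𝓝 z₀)) (hz₀ : -z₀ ∈ Ω)
    (hμ : Tendsto μ atTop atTop) :
    (⋃ n : ℕ, (fun w => μ n • (z n + w)) '' Ω) = Set.univ := by
  refine Set.eq_univ_of_forall fun x => ?_
  have h1 : Tendsto (fun n => (μ n)⁻¹ • x - z n) atTop (𝓝 (-z₀)) := by
    have h := ((tendsto_inv_atTop_zero.comp hμ).smul_const x).sub hz
    simpa using h
  obtain ⟨n, hn⟩ := (h1.eventually (hΩ.mem_nhds hz₀)).exists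
  refine Set.mem_iUnion.2 ⟨n, _, hn, ?_⟩
  have hne := (hμpos n).ne'
  simp [smul_smul, hne]
end

section
/- Let N ≥ 2 and let q be a real number with 1 ≤ q < N/(N−1). Let B denote the open unit ball in ℝ^N. Then there exists a constant C = C(N,q) > 0 such that every function u that is superharmonic and nonnegative on B satisfies u(x) ≥ C · ‖u‖_{L^q(B)} · (1 − |x|) for all x ∈ B, where ‖u‖_{L^q(B)} = (∫_B u^q dx)^{1/q} and 1 − |x| is the distance from x to the boundary sphere ∂B. -/
open MeasureTheory

/-- The Euclidean Laplacian of `u` at `x`: the sum of the pure second partial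
derivatives along the standard coordinate directions. -/
noncomputable def laplacian {N : ℕ} (u : EuclideanSpace ℝ (Fin N) → ℝ)
    (x : EuclideanSpace ℝ (Fin N)) : ℝ :=
  ∑ i : Fin N,
    fderiv ℝ (fun y => fderiv ℝ u y (EuclideanSpace.single i 1)) x
      (EuclideanSpace.single i 1)

open Set Filter Topology

lemma laplacian_congr {N : ℕ} {u v : EuclideanSpace ℝ (Fin N) → ℝ}
    {x : EuclideanSpace ℝ (Fin N)} (h : u =ᶠ[𝓝 x] v) : laplacian u x = laplacian v x := by
  unfold laplacian
  refine Finset.sum_congr rfl fun i _ => ?_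
  have : (fun y => fderiv ℝ u y (EuclideanSpace.single i 1)) =ᶠ[𝓝 x]
      (fun y => fderiv ℝ v y (EuclideanSpace.single i 1)) := by
    filter_upwards [h.eventuallyEq_nhds] with y hy
    rw [hy.fderiv_eq]
  rw [this.fderiv_eq]

lemma cutoff_ext {N : ℕ} {u : EuclideanSpace ℝ (Fin N) → ℝ}
    (hu : ContDiffOn ℝ 2 u (Metric.ball 0 1)) {r : ℝ} (hr0 : 0 < r) (hr : r < 1) :
    ∃ U : EuclideanSpace ℝ (Fin N) → ℝ, ContDiff ℝ 2 U ∧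
      ∀ x ∈ Metric.ball (0 : EuclideanSpace ℝ (Fin N)) r, U x = u x := by
  let f : ContDiffBump (0 : EuclideanSpace ℝ (Fin N)) :=
    ⟨r, (r + 1) / 2, hr0, by linarith⟩
  refine ⟨fun x => f x * u x, ?_, ?_⟩
  · rw [contDiff_iff_contDiffAt]
    intro x
    by_cases hx : x ∈ Metric.ball (0 : EuclideanSpace ℝ (Fin N)) 1
    · exact (f.contDiff.contDiffAt).mul (hu.contDiffAt (Metric.isOpen_ball.mem_nhds hx))
    · have h1 : x ∉ tsupport f := by
        rw [f.tsupport_eq]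
        simp only [Metric.mem_ball, Metric.mem_closedBall, dist_zero_right] at hx ⊢
        have : f.rOut = (r + 1) / 2 := rfl
        rw [this]; linarith
      have h2 : (fun x => f x * u x) =ᶠ[𝓝 x] fun _ => 0 := by
        filter_upwards [(isClosed_tsupport f).isOpen_compl.mem_nhds h1] with y hy
        rw [image_eq_zero_of_notMem_tsupport hy, zero_mul]
      exact contDiffAt_const.congr_of_eventuallyEq h2
  · intro x hx
    simp only
    rw [f.one_of_mem_closedBall (Metric.ball_subset_closedBall hx), one_mul]

lemma contDiff_pd {N : ℕ} {u : EuclideanSpace ℝ (Fin N) → ℝ} (hu : ContDiff ℝ 2 u)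
    (e : EuclideanSpace ℝ (Fin N)) : ContDiff ℝ 1 (fun y => fderiv ℝ u y e) :=
  (hu.fderiv_right (m := 1) (by norm_num)).clm_apply contDiff_const

lemma continuous_ppd {N : ℕ} {u : EuclideanSpace ℝ (Fin N) → ℝ} (hu : ContDiff ℝ 2 u)
    (e : EuclideanSpace ℝ (Fin N)) :
    Continuous (fun y => fderiv ℝ (fun z => fderiv ℝ u z e) y e) :=
  ((contDiff_pd hu e).continuous_fderiv (by norm_num)).clm_apply continuous_const

lemma continuous_laplacian {N : ℕ} {u : EuclideanSpace ℝ (Fin N) → ℝ} (hu : ContDiff ℝ 2 u) :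
    Continuous (laplacian u) :=
  continuous_finsetSum _ fun _ _ => continuous_ppd hu _

lemma hcs_pd {N : ℕ} {u : EuclideanSpace ℝ (Fin N) → ℝ} (hu : HasCompactSupport u)
    (e : EuclideanSpace ℝ (Fin N)) : HasCompactSupport (fun y => fderiv ℝ u y e) := by
  exact hu.fderiv_apply (𝕜 := ℝ) e

lemma ibp {N : ℕ} {f g : EuclideanSpace ℝ (Fin N) → ℝ} (hf : ContDiff ℝ 1 f)
    (hg : ContDiff ℝ 1 g) (hc : HasCompactSupport g) (e : EuclideanSpace ℝ (Fin N)) :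
    ∫ x, f x * fderiv ℝ g x e = - ∫ x, fderiv ℝ f x e * g x := by
  have cf := (hf.continuous_fderiv (by norm_num)).clm_apply (continuous_const (y := e))
  have cg := (hg.continuous_fderiv (by norm_num)).clm_apply (continuous_const (y := e))
  refine integral_mul_fderiv_eq_neg_fderiv_mul_of_integrable ?_ ?_ ?_ ?_ ?_
  · exact (cf.mul hg.continuous).integrable_of_hasCompactSupport hc.mul_left
  · exact (hf.continuous.mul cg).integrable_of_hasCompactSupport (hcs_pd hc e).mul_left
  · exact (hf.continuous.mul hg.continuous).integrable_of_hasCompactSupport hc.mul_left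
  · exact fun x _ => hf.differentiable (by norm_num) x
  · exact fun x _ => hg.differentiable (by norm_num) x

lemma hcs_laplacian {N : ℕ} {u : EuclideanSpace ℝ (Fin N) → ℝ} (hu : HasCompactSupport u) :
    HasCompactSupport (laplacian u) := by
  refine HasCompactSupport.of_support_subset_isCompact hu ?_
  intro x hx
  by_contra h
  apply hx
  have h2 : u =ᶠ[𝓝 x] fun _ => 0 := notMem_tsupport_iff_eventuallyEq.mp h
  rw [laplacian_congr h2]
  simp [laplacian]

lemma green {N : ℕ} {f g : EuclideanSpace ℝ (Fin N) → ℝ} (hf : ContDiff ℝ 2 f)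
    (hg : ContDiff ℝ 2 g) (hc : HasCompactSupport g) :
    ∫ x, f x * laplacian g x = ∫ x, laplacian f x * g x := by
  unfold laplacian
  simp_rw [Finset.mul_sum, Finset.sum_mul]
  rw [integral_finsetSum, integral_finsetSum]
  · refine Finset.sum_congr rfl fun i _ => ?_
    rw [ibp (hf.of_le (by norm_num)) (contDiff_pd hg _) (hcs_pd hc _)]
    rw [ibp (contDiff_pd hf _) (hg.of_le (by norm_num)) hc, neg_neg]
  · intro i _
    exact ((continuous_ppd hf _).mul hg.continuous).integrable_of_hasCompactSupport hc.mul_left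
  · intro i _
    exact (hf.continuous.mul (continuous_ppd hg _)).integrable_of_hasCompactSupport
      (hcs_pd (hcs_pd hc _) _).mul_left

lemma hasFDerivAt_radial {N : ℕ} {F : ℝ → ℝ} {F1 : ℝ} (x : EuclideanSpace ℝ (Fin N))
    (h1 : HasDerivAt F F1 (‖x‖ ^ 2)) :
    HasFDerivAt (fun y : EuclideanSpace ℝ (Fin N) => F (‖y‖ ^ 2))
      (F1 • ((2 : ℝ) • innerSL ℝ x)) x := by
  have h := (hasStrictFDerivAt_norm_sq x).hasFDerivAt
  have := h1.comp_hasFDerivAt x h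
  rw [two_smul ℕ] at this
  rw [two_smul ℝ]
  exact this

lemma inner_single' {N : ℕ} (x : EuclideanSpace ℝ (Fin N)) (i : Fin N) :
    innerSL ℝ x (EuclideanSpace.single i 1) = x i := by
  simp [EuclideanSpace.inner_single_right]

lemma laplacian_radial {N : ℕ} {F F1 F2 : ℝ → ℝ}
    (h1 : ∀ t, HasDerivAt F (F1 t) t) (h2 : ∀ t, HasDerivAt F1 (F2 t) t)
    (x : EuclideanSpace ℝ (Fin N)) :
    laplacian (fun y : EuclideanSpace ℝ (Fin N) => F (‖y‖ ^ 2)) x =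
      4 * ‖x‖ ^ 2 * F2 (‖x‖ ^ 2) + 2 * N * F1 (‖x‖ ^ 2) := by
  unfold laplacian
  have e1 : ∀ i : Fin N, (fun y : EuclideanSpace ℝ (Fin N) =>
      fderiv ℝ (fun y : EuclideanSpace ℝ (Fin N) => F (‖y‖ ^ 2)) y (EuclideanSpace.single i 1)) =
      fun y => F1 (‖y‖ ^ 2) * (2 * y i) := by
    intro i; funext y
    rw [(hasFDerivAt_radial y (h1 _)).fderiv]
    simp only [smul_apply, inner_single', smul_eq_mul]
  have e2 : ∀ i : Fin N, fderiv ℝ (fun y : EuclideanSpace ℝ (Fin N) => F1 (‖y‖ ^ 2) * (2 * y i)) x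
      (EuclideanSpace.single i 1) = 4 * (x i) ^ 2 * F2 (‖x‖ ^ 2) + 2 * F1 (‖x‖ ^ 2) := by
    intro i
    have a := hasFDerivAt_radial x (h2 _)
    have b : HasFDerivAt (fun y : EuclideanSpace ℝ (Fin N) => 2 * y i)
        ((2 : ℝ) • (EuclideanSpace.proj i : EuclideanSpace ℝ (Fin N) →L[ℝ] ℝ)) x :=
      (EuclideanSpace.proj i : EuclideanSpace ℝ (Fin N) →L[ℝ] ℝ).hasFDerivAt.const_mul 2
    have c := (a.mul b).fderiv
    have d : ((fun y : EuclideanSpace ℝ (Fin N) => F1 (‖y‖ ^ 2)) * fun y => 2 * y i) =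
        fun y => F1 (‖y‖ ^ 2) * (2 * y i) := rfl
    rw [d] at c
    rw [c]
    simp only [add_apply, smul_apply, inner_single',
      smul_eq_mul]
    simp
    ring
  simp_rw [e1, e2]
  rw [Finset.sum_add_distrib, ← Finset.sum_mul, ← Finset.mul_sum]
  have : ∑ i : Fin N, (x i) ^ 2 = ‖x‖ ^ 2 := by
    rw [EuclideanSpace.norm_sq_eq]; simp
  rw [this]
  simp
  ring


lemma laplacian_sub {N : ℕ} {u v : EuclideanSpace ℝ (Fin N) → ℝ} {x : EuclideanSpace ℝ (Fin N)}
    (hu : ContDiffAt ℝ 2 u x) (hv : ContDiffAt ℝ 2 v x) :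
    laplacian (fun y => u y - v y) x = laplacian u x - laplacian v x := by
  unfold laplacian
  rw [← Finset.sum_sub_distrib]
  refine Finset.sum_congr rfl fun i _ => ?_
  have hd : ∀ {f : EuclideanSpace ℝ (Fin N) → ℝ}, ContDiffAt ℝ 2 f x →
      DifferentiableAt ℝ (fun y => fderiv ℝ f y (EuclideanSpace.single i 1)) x := by
    intro f hf
    have := (hf.fderiv_right (m := 1) (by norm_num)).differentiableAt (by norm_num)
    exact this.clm_apply (differentiableAt_const _)
  have hn : ∀ {f : EuclideanSpace ℝ (Fin N) → ℝ}, ContDiffAt ℝ 2 f x →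
      ∀ᶠ y in 𝓝 x, DifferentiableAt ℝ f y := by
    intro f hf
    filter_upwards [hf.eventually (by simp)] with y hy
    exact hy.differentiableAt (by norm_num)
  have e : (fun y => fderiv ℝ (fun y => u y - v y) y (EuclideanSpace.single i 1)) =ᶠ[𝓝 x]
      (fun y => fderiv ℝ u y (EuclideanSpace.single i 1) -
        fderiv ℝ v y (EuclideanSpace.single i 1)) := by
    filter_upwards [hn hu, hn hv] with y h1 h2
    rw [fderiv_fun_sub h1 h2]; rfl
  rw [e.fderiv_eq, fderiv_fun_sub (hd hu) (hd hv)]; rfl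

lemma laplacian_nonneg_of_isLocalMin {N : ℕ} {w : EuclideanSpace ℝ (Fin N) → ℝ}
    {x : EuclideanSpace ℝ (Fin N)} (hw : ContDiffAt ℝ 2 w x) (hm : IsLocalMin w x) :
    0 ≤ laplacian w x := by
  unfold laplacian
  refine Finset.sum_nonneg fun i _ => ?_
  set e : EuclideanSpace ℝ (Fin N) := EuclideanSpace.single i 1
  by_contra! hneg
  let γ : ℝ → EuclideanSpace ℝ (Fin N) := fun t => x + t • e
  have hγ : ∀ t, HasDerivAt γ e t := fun t => by
    have := ((hasDerivAt_id t).smul_const e).const_add x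
    rw [one_smul] at this
    exact this
  have hγ0 : γ 0 = x := by simp [γ]
  have hγc : Tendsto γ (𝓝 0) (𝓝 x) := by
    have := (hγ 0).continuousAt
    unfold ContinuousAt at this; rwa [hγ0] at this
  have hd1 : deriv (fun t => w (γ t)) =ᶠ[𝓝 0] fun t => fderiv ℝ w (γ t) e := by
    filter_upwards [hγc.eventually (hw.eventually (by simp))] with t ht
    have : HasFDerivAt w (fderiv ℝ w (γ t)) (γ t) :=
      (ht.differentiableAt (by norm_num)).hasFDerivAt
    exact (this.comp_hasDerivAt t (hγ t)).deriv
  have hD : DifferentiableAt ℝ (fun y => fderiv ℝ w y e) x :=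
    ((hw.fderiv_right (m := 1) (by norm_num)).differentiableAt (by norm_num)).clm_apply
      (differentiableAt_const _)
  have hd2 : deriv (deriv (fun t => w (γ t))) 0 = fderiv ℝ (fun y => fderiv ℝ w y e) x e := by
    rw [hd1.deriv_eq]
    have h := hD.hasFDerivAt
    rw [← hγ0] at h
    have := (h.comp_hasDerivAt (0 : ℝ) (hγ 0)).deriv
    rw [hγ0] at this
    exact this
  have hmin : IsLocalMin (fun t => w (γ t)) 0 := by
    have := hγc.eventually hm
    unfold IsLocalMin IsMinFilter
    simpa [hγ0] using this
  have hcont : ContinuousAt (fun t => w (γ t)) 0 := by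
    have : ContinuousAt w (γ 0) := by rw [hγ0]; exact hw.continuousAt
    exact ContinuousAt.comp this (hγ 0).continuousAt
  have hmax : IsLocalMax (fun t => w (γ t)) 0 :=
    isLocalMax_of_deriv_deriv_neg (by rw [hd2]; exact hneg) hmin.deriv_eq_zero hcont
  have hconst : (fun t => w (γ t)) =ᶠ[𝓝 0] fun _ => w (γ 0) := by
    filter_upwards [hmin, hmax] with t h1 h2
    exact le_antisymm h2 h1
  have h3 : deriv (fun t => w (γ t)) =ᶠ[𝓝 0] fun _ => 0 := by
    filter_upwards [hconst.eventuallyEq_nhds] with t ht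
    rw [ht.deriv_eq]; simp
  have : deriv (deriv (fun t => w (γ t))) 0 = 0 := by
    rw [h3.deriv_eq]; simp
  rw [hd2] at this
  linarith

lemma barrier {N : ℕ} (hN : 2 ≤ N) {τ : ℝ} (hτ : 0 < τ) (hτ1 : τ < 1) :
    ∃ c > (0 : ℝ), ∀ u : EuclideanSpace ℝ (Fin N) → ℝ,
      ContDiffOn ℝ 2 u (Metric.ball (0 : EuclideanSpace ℝ (Fin N)) 1) →
      (∀ x ∈ Metric.ball (0 : EuclideanSpace ℝ (Fin N)) 1, 0 ≤ u x) →
      (∀ x ∈ Metric.ball (0 : EuclideanSpace ℝ (Fin N)) 1, laplacian u x ≤ 0) →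
      ∀ m : ℝ, 0 ≤ m → (∀ x, ‖x‖ ≤ τ → m ≤ u x) →
      ∀ x ∈ Metric.ball (0 : EuclideanSpace ℝ (Fin N)) 1, c * m * (1 - ‖x‖) ≤ u x := by
  set α : ℝ := N / τ ^ 2 with hα
  have hNpos : (0 : ℝ) < N := by exact_mod_cast (by omega : 0 < N)
  have hαpos : 0 < α := by positivity
  refine ⟨α * Real.exp (-α), by positivity, ?_⟩
  intro u hu h0 hs m hm hmu x0 hx0
  rcases hm.eq_or_lt with rfl | hm
  · simpa using h0 x0 hx0
  let F : ℝ → ℝ := fun t => m * (Real.exp (-(α * t)) - Real.exp (-α))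
  let F1 : ℝ → ℝ := fun t => m * (Real.exp (-(α * t)) * -α)
  let F2 : ℝ → ℝ := fun t => m * (Real.exp (-(α * t)) * -α * -α)
  have hlin : ∀ t, HasDerivAt (fun t => -(α * t)) (-α) t := fun t => by
    have := ((hasDerivAt_id t).const_mul α).neg
    rw [mul_one] at this
    exact this
  have hF1 : ∀ t, HasDerivAt F (F1 t) t := fun t =>
    (((hlin t).exp).sub_const _).const_mul m
  have hF2 : ∀ t, HasDerivAt F1 (F2 t) t := fun t =>
    (((hlin t).exp).mul_const _).const_mul m
  have hFc : ContDiff ℝ 2 (fun y : EuclideanSpace ℝ (Fin N) => F (‖y‖ ^ 2)) := by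
    have := contDiff_norm_sq ℝ (E := EuclideanSpace ℝ (Fin N)) (n := 2)
    have h2 : ContDiff ℝ 2 F := by fun_prop
    exact h2.comp this
  -- claim
  have key : F (‖x0‖ ^ 2) ≤ u x0 := by
    by_contra! hlt
    have hx0' : ‖x0‖ < 1 := by simpa using hx0
    have hFcont : Continuous (fun R : ℝ => F (R ^ 2)) := by fun_prop
    have hlim : Tendsto (fun R : ℝ => F (R ^ 2)) (𝓝[<] 1) (𝓝 0) := by
      have := (hFcont.tendsto 1).mono_left (nhdsWithin_le_nhds (s := Iio 1))
      simpa [F] using this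
    have hev : ∀ᶠ R in 𝓝[<] (1 : ℝ), F (R ^ 2) < F (‖x0‖ ^ 2) - u x0 ∧ ‖x0‖ < R ∧ R < 1 := by
      refine (hlim.eventually (gt_mem_nhds (by linarith))).and (Eventually.and ?_ ?_)
      · exact nhdsWithin_le_nhds (lt_mem_nhds hx0')
      · exact self_mem_nhdsWithin
    obtain ⟨R, hR1, hR2, hR3⟩ := hev.exists
    have hsub : Metric.closedBall (0 : EuclideanSpace ℝ (Fin N)) R ⊆ Metric.ball 0 1 :=
      Metric.closedBall_subset_ball hR3
    have hwc : ContinuousOn (fun y => u y - F (‖y‖ ^ 2))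
        (Metric.closedBall (0 : EuclideanSpace ℝ (Fin N)) R) :=
      (hu.continuousOn.mono hsub).sub hFc.continuous.continuousOn
    obtain ⟨x1, hx1, hmin⟩ := (isCompact_closedBall (0 : EuclideanSpace ℝ (Fin N)) R).exists_isMinOn
      ⟨x0, by simpa using hR2.le⟩ hwc
    have hle : u x1 - F (‖x1‖ ^ 2) ≤ u x0 - F (‖x0‖ ^ 2) :=
      hmin (by simpa using hR2.le : x0 ∈ Metric.closedBall (0 : EuclideanSpace ℝ (Fin N)) R)
    have hx1n : ‖x1‖ ≤ R := by simpa using hx1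
    have hx1b := hsub hx1
    have hne : ‖x1‖ ≠ R := by
      intro h
      rw [h] at hle
      have := h0 x1 hx1b
      linarith
    have hgt : τ < ‖x1‖ := by
      by_contra! h
      have h2 := hmu x1 h
      have h3 : F (‖x1‖ ^ 2) ≤ m := by
        have : Real.exp (-(α * ‖x1‖ ^ 2)) ≤ 1 := by
          rw [Real.exp_le_one_iff]; have := sq_nonneg ‖x1‖; nlinarith
        have h4 := Real.exp_pos (-α)
        simp only [F]
        nlinarith
      linarith
    have hloc : IsLocalMin (fun y => u y - F (‖y‖ ^ 2)) x1 := by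
      refine hmin.isLocalMin ?_
      refine mem_of_superset (Metric.isOpen_ball.mem_nhds
        (?_ : x1 ∈ Metric.ball (0 : EuclideanSpace ℝ (Fin N)) R)) Metric.ball_subset_closedBall
      simpa using lt_of_le_of_ne hx1n hne
    have hua := hu.contDiffAt (Metric.isOpen_ball.mem_nhds hx1b)
    have hL := laplacian_nonneg_of_isLocalMin (hua.sub hFc.contDiffAt) hloc
    rw [laplacian_sub hua hFc.contDiffAt, laplacian_radial hF1 hF2] at hL
    have := hs x1 hx1b
    have h5 : 0 < 4 * ‖x1‖ ^ 2 * F2 (‖x1‖ ^ 2) + 2 * ↑N * F1 (‖x1‖ ^ 2) := by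
      have e : 4 * ‖x1‖ ^ 2 * F2 (‖x1‖ ^ 2) + 2 * ↑N * F1 (‖x1‖ ^ 2) =
        2 * m * Real.exp (-(α * ‖x1‖ ^ 2)) * α * (2 * (α * ‖x1‖ ^ 2) - N) := by
        simp only [F1, F2]; ring
      rw [e]
      have h6 : (N : ℝ) ≤ α * ‖x1‖ ^ 2 := by
        have : (N : ℝ) = α * τ ^ 2 := by rw [hα]; field_simp
        rw [this]; gcongr
      have : 0 < 2 * (α * ‖x1‖ ^ 2) - N := by linarith
      positivity
    linarith
  refine le_trans ?_ key
  have hx0' : ‖x0‖ < 1 := by simpa using hx0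
  have e1 : Real.exp (-(α * ‖x0‖ ^ 2)) = Real.exp (-α) * Real.exp (α * (1 - ‖x0‖ ^ 2)) := by
    rw [← Real.exp_add]; congr 1; ring
  have e2 := Real.add_one_le_exp (α * (1 - ‖x0‖ ^ 2))
  have e3 : 1 - ‖x0‖ ≤ 1 - ‖x0‖ ^ 2 := by nlinarith [norm_nonneg x0]
  simp only [F]
  rw [e1]
  calc α * Real.exp (-α) * m * (1 - ‖x0‖) = m * (Real.exp (-α) * (α * (1 - ‖x0‖))) := by ring
    _ ≤ m * (Real.exp (-α) * (Real.exp (α * (1 - ‖x0‖ ^ 2)) - 1)) := by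
        gcongr
        nlinarith
    _ = _ := by ring


lemma hasDerivAt_pospow (n : ℕ) (y : ℝ) :
    HasDerivAt (fun y : ℝ => (max y 0) ^ (n + 2)) ((n + 2) * (max y 0) ^ (n + 1)) y := by
  rcases lt_trichotomy y 0 with h | h | h
  · have e : (fun y : ℝ => (max y 0) ^ (n + 2)) =ᶠ[𝓝 y] fun _ => 0 := by
      filter_upwards [gt_mem_nhds h] with z hz
      rw [max_eq_right hz.le]; simp
    rw [max_eq_right h.le]
    simpa using (hasDerivAt_const y (0 : ℝ)).congr_of_eventuallyEq e
  · subst h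
    rw [hasDerivAt_iff_isLittleO_nhds_zero]
    simp only [zero_add, max_self]
    rw [Asymptotics.isLittleO_iff]
    intro c hc
    have h1 : ∀ᶠ z : ℝ in 𝓝 0, |z| < min c 1 := by
      have : Tendsto (fun z : ℝ => |z|) (𝓝 0) (𝓝 0) := by
        simpa using (continuous_abs.tendsto (0 : ℝ))
      exact this.eventually (gt_mem_nhds (by positivity))
    filter_upwards [h1] with z hz
    have h2 : 0 ≤ max z 0 := le_max_right _ _
    have h3 : max z 0 ≤ |z| := max_le (le_abs_self z) (abs_nonneg z)
    have h4 := lt_min_iff.1 hz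
    simp only [ne_eq, Nat.add_eq_zero_iff, OfNat.ofNat_ne_zero, and_false, not_false_eq_true,
      zero_pow, sub_zero, one_ne_zero, mul_zero, smul_eq_mul]
    rw [Real.norm_of_nonneg (by positivity), Real.norm_eq_abs]
    calc (max z 0) ^ (n + 2) = (max z 0) ^ n * (max z 0 * max z 0) := by ring
      _ ≤ 1 * (c * |z|) := by
        gcongr
        · exact pow_le_one₀ h2 (by linarith)
        · linarith
      _ = _ := by ring
  · have e : (fun y : ℝ => (max y 0) ^ (n + 2)) =ᶠ[𝓝 y] fun y => y ^ (n + 2) := by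
      filter_upwards [lt_mem_nhds h] with z hz
      rw [max_eq_left hz.le]
    rw [max_eq_left h.le]
    have := (hasDerivAt_pow (n + 2) y).congr_of_eventuallyEq e
    simpa using this

lemma contDiff_pospow (n : ℕ) : ContDiff ℝ n (fun y : ℝ => (max y 0) ^ (n + 1)) := by
  induction n with
  | zero => exact contDiff_zero.2 (by fun_prop)
  | succ n ih =>
    have : ((n + 1 : ℕ) : WithTop ℕ∞) = (n : WithTop ℕ∞) + 1 := by push_cast; rfl
    rw [this, contDiff_succ_iff_deriv]
    refine ⟨fun y => (hasDerivAt_pospow n y).differentiableAt, by simp, ?_⟩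
    have e : deriv (fun y : ℝ => (max y 0) ^ (n + 1 + 1)) =
        fun y => ((n : ℝ) + 2) * (max y 0) ^ (n + 1) := by
      funext y; exact (hasDerivAt_pospow n y).deriv
    rw [e]
    exact contDiff_const.mul ih

lemma mean_value {N : ℕ} {U : EuclideanSpace ℝ (Fin N) → ℝ} (hU : ContDiff ℝ 2 U)
    (x : EuclideanSpace ℝ (Fin N)) {R : ℝ} (hR : 0 < R)
    (hL : ∀ y, ‖y - x‖ < R → laplacian U y ≤ 0) :
    ∫ y, U (x + R • y) * (max (1 - ‖y‖ ^ 2) 0) ^ 2 ≤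
      U x * ∫ y : EuclideanSpace ℝ (Fin N), (max (1 - ‖y‖ ^ 2) 0) ^ 2 := by
  set ρ : EuclideanSpace ℝ (Fin N) → ℝ := fun y => (max (1 - ‖y‖ ^ 2) 0) ^ 2 with hρ
  have hρc : Continuous ρ := by fun_prop
  have hsupp : ∀ y : EuclideanSpace ℝ (Fin N), y ∉ Metric.closedBall (0 : EuclideanSpace ℝ (Fin N)) 1 →
      max (1 - ‖y‖ ^ 2) 0 = 0 := by
    intro y hy
    have : 1 < ‖y‖ := by simpa using hy
    exact max_eq_right (by nlinarith)
  have hρs : HasCompactSupport ρ := by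
    refine HasCompactSupport.intro (isCompact_closedBall (0 : EuclideanSpace ℝ (Fin N)) 1) ?_
    intro y hy
    simp only [hρ]; rw [hsupp y hy]; simp
  let M : ℝ → ℝ := fun r => ∫ y, U (x + r • y) * ρ y
  let F' : ℝ → EuclideanSpace ℝ (Fin N) → ℝ := fun r y => fderiv ℝ U (x + r • y) y * ρ y
  have hfc : Continuous (fderiv ℝ U) := hU.continuous_fderiv (by norm_num)
  have hF'c : Continuous (fun p : ℝ × EuclideanSpace ℝ (Fin N) => F' p.1 p.2) := by
    have : Continuous (fun p : ℝ × EuclideanSpace ℝ (Fin N) => fderiv ℝ U (x + p.1 • p.2) p.2) :=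
      (hfc.comp (by fun_prop)).clm_apply continuous_snd
    exact this.mul (hρc.comp continuous_snd)
  have hUc := hU.continuous
  have hM : ∀ r, HasDerivAt M (∫ y, F' r y) r := by
    intro r
    obtain ⟨K, hK⟩ := ((isCompact_Icc (a := r - 1) (b := r + 1)).prod
      (isCompact_closedBall (0 : EuclideanSpace ℝ (Fin N)) 1)).exists_bound_of_continuousOn
      hF'c.continuousOn
    refine (hasDerivAt_integral_of_dominated_loc_of_deriv_le (F := fun r y => U (x + r • y) * ρ y)
      (bound := (Metric.closedBall (0 : EuclideanSpace ℝ (Fin N)) 1).indicator fun _ => K)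
      (s := Icc (r - 1) (r + 1)) (Icc_mem_nhds (by linarith) (by linarith)) ?_ ?_ ?_ ?_ ?_ ?_).2
    · exact Eventually.of_forall fun r' =>
        ((hUc.comp (by fun_prop)).mul hρc).aestronglyMeasurable
    · exact ((hUc.comp (by fun_prop)).mul hρc).integrable_of_hasCompactSupport hρs.mul_left
    · exact (hF'c.comp (by fun_prop : Continuous fun y => (r, y))).aestronglyMeasurable
    · refine Eventually.of_forall fun y r' hr' => ?_
      by_cases hy : y ∈ Metric.closedBall (0 : EuclideanSpace ℝ (Fin N)) 1
      · rw [indicator_of_mem hy]; exact hK (r', y) ⟨hr', hy⟩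
      · rw [indicator_of_notMem hy]
        simp only [F', hρ]; rw [hsupp y hy]; simp
    · refine (integrable_indicator_iff measurableSet_closedBall).2 ?_
      exact integrableOn_const (by exact measure_closedBall_lt_top.ne)
    · refine Eventually.of_forall fun y r' _ => ?_
      have hγ : HasDerivAt (fun t : ℝ => x + t • y) y r' := by
        have := ((hasDerivAt_id r').smul_const y).const_add x
        rw [one_smul] at this
        exact this
      have : HasFDerivAt U (fderiv ℝ U (x + r' • y)) (x + r' • y) :=
        (hU.differentiable (by norm_num) _).hasFDerivAt
      exact (this.comp_hasDerivAt r' hγ).mul_const _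
  -- the potential
  let S : ℝ → ℝ := fun t => -(1/6) * (max (1 - t) 0) ^ 3
  let S1 : ℝ → ℝ := fun t => (1/2) * (max (1 - t) 0) ^ 2
  have hS1 : ∀ t, HasDerivAt S (S1 t) t := by
    intro t
    have h := (hasDerivAt_pospow 1 (1 - t)).comp t ((hasDerivAt_id t).const_sub 1)
    have := h.const_mul (-(1/6) : ℝ)
    refine HasDerivAt.congr_deriv this ?_
    simp only [S1]; push_cast; ring
  let σ : EuclideanSpace ℝ (Fin N) → ℝ := fun y => S (‖y‖ ^ 2)
  have hσc : ContDiff ℝ 1 σ := by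
    have h1 : ContDiff ℝ 1 (fun y : ℝ => (max y 0) ^ 3) := by
      have := contDiff_pospow 2
      exact this.of_le (by norm_num)
    have h2 := contDiff_norm_sq ℝ (E := EuclideanSpace ℝ (Fin N)) (n := 1)
    exact contDiff_const.mul (h1.comp (contDiff_const.sub h2))
  have hσs : HasCompactSupport σ := by
    refine HasCompactSupport.intro (isCompact_closedBall (0 : EuclideanSpace ℝ (Fin N)) 1) ?_
    intro y hy
    simp only [σ, S]; rw [hsupp y hy]; simp
  have hσd : ∀ (i : Fin N) y, fderiv ℝ σ y (EuclideanSpace.single i 1) = y i * ρ y := by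
    intro i y
    rw [(hasFDerivAt_radial y (hS1 _)).fderiv]
    simp only [smul_apply, inner_single', smul_eq_mul, S1, hρ]
    ring
  have hσn : ∀ y, σ y ≤ 0 := by
    intro y
    have : 0 ≤ (max (1 - ‖y‖ ^ 2) 0) ^ 3 := pow_nonneg (le_max_right _ _) 3
    simp only [σ, S]; linarith
  have hM' : ∀ r, 0 < r → r < R → ∫ y, F' r y ≤ 0 := by
    intro r hr hrR
    have hG : ∀ i : Fin N, ContDiff ℝ 1 (fun y => fderiv ℝ U (x + r • y) (EuclideanSpace.single i 1)) :=
      fun i => (contDiff_pd hU _).comp (by fun_prop)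
    have e1 : ∀ y, F' r y = ∑ i : Fin N, fderiv ℝ U (x + r • y) (EuclideanSpace.single i 1) *
        fderiv ℝ σ y (EuclideanSpace.single i 1) := by
      intro y
      simp only [F', hσd]
      have hy : y = ∑ i : Fin N, y i • EuclideanSpace.single i (1 : ℝ) := by
        have := (EuclideanSpace.basisFun (Fin N) ℝ).sum_repr y
        simpa using this.symm
      conv_lhs => rw [hy]
      rw [map_sum, ← hy, Finset.sum_mul]
      refine Finset.sum_congr rfl fun i _ => ?_
      rw [map_smul, smul_eq_mul]; ring
    simp_rw [e1]
    have hpd : ∀ i : Fin N, Continuous (fun y => fderiv ℝ (fun y => fderiv ℝ U (x + r • y)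
        (EuclideanSpace.single i 1)) y (EuclideanSpace.single i 1)) := fun i =>
      ((hG i).continuous_fderiv (by norm_num)).clm_apply continuous_const
    have hσpd : ∀ i : Fin N, Continuous (fun y => fderiv ℝ σ y (EuclideanSpace.single i 1)) :=
      fun i => (hσc.continuous_fderiv (by norm_num)).clm_apply continuous_const
    have i1 : ∀ i ∈ Finset.univ, Integrable (fun y => fderiv ℝ U (x + r • y)
        (EuclideanSpace.single i 1) * fderiv ℝ σ y (EuclideanSpace.single i 1)) := fun i _ =>
      ((hG i).continuous.mul (hσpd i)).integrable_of_hasCompactSupport (hcs_pd hσs _).mul_left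
    have i2 : ∀ i ∈ Finset.univ, Integrable (fun y => fderiv ℝ (fun y => fderiv ℝ U (x + r • y)
        (EuclideanSpace.single i 1)) y (EuclideanSpace.single i 1) * σ y) := fun i _ =>
      ((hpd i).mul hσc.continuous).integrable_of_hasCompactSupport hσs.mul_left
    rw [integral_finsetSum _ i1]
    simp_rw [ibp (hG _) hσc hσs]
    rw [Finset.sum_neg_distrib, ← integral_finsetSum _ i2]
    rw [neg_nonpos]
    refine integral_nonneg fun y => ?_
    simp only [Pi.zero_apply]
    rw [← Finset.sum_mul]
    have e2 : ∑ i : Fin N, fderiv ℝ (fun y => fderiv ℝ U (x + r • y)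
        (EuclideanSpace.single i 1)) y (EuclideanSpace.single i 1) = r * laplacian U (x + r • y) := by
      unfold laplacian
      rw [Finset.mul_sum]
      refine Finset.sum_congr rfl fun i _ => ?_
      have h1 : HasFDerivAt (fun y : EuclideanSpace ℝ (Fin N) => x + r • y)
          (r • ContinuousLinearMap.id ℝ (EuclideanSpace ℝ (Fin N))) y :=
        ((hasFDerivAt_id y).const_smul r).const_add x
      have h2 : HasFDerivAt (fun y => fderiv ℝ U y (EuclideanSpace.single i 1)) _ (x + r • y) :=
        ((contDiff_pd hU (EuclideanSpace.single i 1)).differentiable (by norm_num) _).hasFDerivAt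
      have h3 := (h2.comp y h1).fderiv
      have h4 : ((fun y => fderiv ℝ U y (EuclideanSpace.single i 1)) ∘ fun y => x + r • y) =
        fun y => fderiv ℝ U (x + r • y) (EuclideanSpace.single i 1) := rfl
      rw [h4] at h3
      rw [h3]
      simp
    rw [e2]
    by_cases hy : ‖y‖ ≤ 1
    · have hl := hL (x + r • y) (by
        rw [add_sub_cancel_left, norm_smul, Real.norm_of_nonneg hr.le]; nlinarith [norm_nonneg y])
      exact mul_nonneg_of_nonpos_of_nonpos (by nlinarith) (hσn y)
    · have : σ y = 0 := by
        simp only [σ, S]; rw [hsupp y (by simpa using hy)]; simp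
      rw [this, mul_zero]
  have hanti : AntitoneOn M (Icc 0 R) := by
    refine antitoneOn_of_deriv_nonpos (convex_Icc 0 R)
      (fun r _ => (hM r).continuousAt.continuousWithinAt)
      (fun r _ => (hM r).differentiableAt.differentiableWithinAt) ?_
    intro r hr
    rw [interior_Icc] at hr
    rw [(hM r).deriv]
    exact hM' r hr.1 hr.2
  have := hanti (left_mem_Icc.2 hR.le) (right_mem_Icc.2 hR.le) hR.le
  refine this.trans (le_of_eq ?_)
  simp only [M, zero_smul, add_zero]
  rw [integral_const_mul]


lemma lower_bound {N : ℕ} (hN : 2 ≤ N) {ρ : ℝ} (hρ0 : 0 < ρ) (hρ1 : ρ < 1) :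
    ∃ c > (0 : ℝ), ∀ u : EuclideanSpace ℝ (Fin N) → ℝ,
      ContDiffOn ℝ 2 u (Metric.ball (0 : EuclideanSpace ℝ (Fin N)) 1) →
      (∀ x ∈ Metric.ball (0 : EuclideanSpace ℝ (Fin N)) 1, 0 ≤ u x) →
      (∀ x ∈ Metric.ball (0 : EuclideanSpace ℝ (Fin N)) 1, laplacian u x ≤ 0) →
      ∀ x ∈ Metric.ball (0 : EuclideanSpace ℝ (Fin N)) 1,
        c * (∫ y in Metric.closedBall (0 : EuclideanSpace ℝ (Fin N)) ρ, u y) * (1 - ‖x‖) ≤ u x := by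
  set τ : ℝ := (1 - ρ) / 4 with hτ
  have hτ0 : 0 < τ := by rw [hτ]; linarith
  have hτ1 : τ < 1 := by rw [hτ]; linarith
  set R : ℝ := 1 - 2 * τ with hR
  have hR0 : ρ + τ < R := by rw [hR, hτ]; linarith
  have hRpos : 0 < R := by linarith
  obtain ⟨c, hc, H⟩ := barrier hN hτ0 hτ1
  set J : ℝ := ∫ y : EuclideanSpace ℝ (Fin N), (max (1 - ‖y‖ ^ 2) 0) ^ 2 with hJ
  have hJ0 : 0 ≤ J := integral_nonneg fun y => by positivity
  set k : ℝ := (1 - ((ρ + τ) / R) ^ 2) ^ 2 with hk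
  have hq1 : (ρ + τ) / R < 1 := by rw [div_lt_one hRpos]; exact hR0
  have hq0 : 0 < (ρ + τ) / R := by positivity
  have hq2 : 0 < 1 - ((ρ + τ) / R) ^ 2 := by nlinarith
  have hk0 : 0 < k := by positivity
  set a : ℝ := |(R ^ Module.finrank ℝ (EuclideanSpace ℝ (Fin N)))⁻¹| with ha
  have ha0 : 0 < a := by positivity
  refine ⟨c * (a * k / (J + 1)), by positivity, ?_⟩
  intro u hu h0 hs
  set I : ℝ := ∫ y in Metric.closedBall (0 : EuclideanSpace ℝ (Fin N)) ρ, u y with hI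
  have hI0 : 0 ≤ I := by
    refine setIntegral_nonneg measurableSet_closedBall fun y hy => h0 y ?_
    exact Metric.closedBall_subset_ball hρ1 hy
  have key : ∀ x : EuclideanSpace ℝ (Fin N), ‖x‖ ≤ τ → a * k / (J + 1) * I ≤ u x := by
    intro x hx
    obtain ⟨U, hU, hUu⟩ := cutoff_ext hu (r := 1 - τ / 2) (by linarith) (by linarith)
    have hin : ∀ y, ‖y - x‖ < R → y ∈ Metric.ball (0 : EuclideanSpace ℝ (Fin N)) (1 - τ / 2) := by
      intro y hy
      have : ‖y‖ ≤ ‖y - x‖ + ‖x‖ := by simpa using norm_add_le (y - x) x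
      simp only [Metric.mem_ball, dist_zero_right]
      linarith
    have hsub : Metric.ball (0 : EuclideanSpace ℝ (Fin N)) (1 - τ / 2) ⊆ Metric.ball 0 1 :=
      Metric.ball_subset_ball (by linarith)
    have hmv := mean_value hU x hRpos (by
      intro y hy
      have : U =ᶠ[𝓝 y] u := by
        filter_upwards [Metric.isOpen_ball.mem_nhds (hin y hy)] with z hz using hUu z hz
      rw [laplacian_congr this]
      exact hs y (hsub (hin y hy)))
    let f : EuclideanSpace ℝ (Fin N) → ℝ :=
      fun z => U z * (max (1 - (‖z - x‖ / R) ^ 2) 0) ^ 2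
    have e1 : ∫ y, U (x + R • y) * (max (1 - ‖y‖ ^ 2) 0) ^ 2 = a * ∫ z, f z := by
      have h1 : ∀ y, U (x + R • y) * (max (1 - ‖y‖ ^ 2) 0) ^ 2 = (fun z => f (x + z)) (R • y) := by
        intro y
        simp only [f]
        rw [add_sub_cancel_left, norm_smul, Real.norm_of_nonneg hRpos.le,
          mul_div_cancel_left₀ _ hRpos.ne']
      rw [integral_congr_ae (Eventually.of_forall h1),
        Measure.integral_comp_smul volume (fun z => f (x + z)) R,
        integral_add_left_eq_self f x, smul_eq_mul]
    have hfz : ∀ z, R ≤ ‖z - x‖ → f z = 0 := by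
      intro z hz
      have : 1 ≤ ‖z - x‖ / R := by rwa [one_le_div hRpos]
      simp only [f]
      rw [max_eq_right (by nlinarith)]; simp
    have hf0 : ∀ z, 0 ≤ f z := by
      intro z
      by_cases hz : ‖z - x‖ < R
      · have := h0 z (hsub (hin z hz))
        simp only [f]; rw [hUu z (hin z hz)]; positivity
      · rw [hfz z (not_lt.1 hz)]
    have hfc : Continuous f := by
      have := hU.continuous
      fun_prop
    have hfs : HasCompactSupport f := by
      refine HasCompactSupport.intro (isCompact_closedBall x R) ?_
      intro z hz
      apply hfz
      have : R < dist z x := by simpa using hz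
      rw [dist_eq_norm] at this; exact this.le
    have hfi : Integrable f := hfc.integrable_of_hasCompactSupport hfs
    have h2 : k * I ≤ ∫ z, f z := by
      calc k * I = ∫ y in Metric.closedBall (0 : EuclideanSpace ℝ (Fin N)) ρ, k * u y := by
            rw [integral_const_mul]
        _ ≤ ∫ y in Metric.closedBall (0 : EuclideanSpace ℝ (Fin N)) ρ, f y := by
            refine setIntegral_mono_on ?_ hfi.integrableOn measurableSet_closedBall ?_
            · refine ContinuousOn.integrableOn_compact (isCompact_closedBall _ _) ?_
              exact continuousOn_const.mul
                (hu.continuousOn.mono (Metric.closedBall_subset_ball hρ1))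
            · intro y hy
              have hyn : ‖y‖ ≤ ρ := by simpa using hy
              have h3 : ‖y - x‖ ≤ ρ + τ := (norm_sub_le y x).trans (by linarith)
              have h4 := hin y (by linarith)
              simp only [f]
              rw [hUu y h4, mul_comm]
              refine mul_le_mul_of_nonneg_left ?_ (h0 y (hsub h4))
              rw [hk]
              have h5 : ‖y - x‖ / R ≤ (ρ + τ) / R := by gcongr
              have h6 : 0 ≤ ‖y - x‖ / R := by positivity
              refine pow_le_pow_left₀ hq2.le (le_max_of_le_left ?_) 2
              nlinarith
        _ ≤ ∫ z, f z := setIntegral_le_integral hfi (Eventually.of_forall hf0)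
    have hx1 : x ∈ Metric.ball (0 : EuclideanSpace ℝ (Fin N)) (1 - τ / 2) :=
      hin x (by simpa using hRpos)
    rw [e1, hUu x hx1] at hmv
    have h7 := h0 x (hsub hx1)
    rw [div_mul_eq_mul_div, div_le_iff₀ (by positivity)]
    have h8 : a * (k * I) ≤ a * ∫ z, f z := by gcongr
    nlinarith
  intro x hx
  have := H u hu h0 hs (a * k / (J + 1) * I) (by positivity) key x hx
  calc _ = c * (a * k / (J + 1) * I) * (1 - ‖x‖) := by ring
    _ ≤ _ := this

lemma norm_sq_le_sum {N : ℕ} (L : EuclideanSpace ℝ (Fin N) →L[ℝ] ℝ) :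
    ‖L‖ ^ 2 ≤ ∑ i : Fin N, (L (EuclideanSpace.single i 1)) ^ 2 := by
  set S := ∑ i : Fin N, (L (EuclideanSpace.single i 1)) ^ 2 with hS
  have hS0 : 0 ≤ S := Finset.sum_nonneg fun i _ => sq_nonneg _
  have : ‖L‖ ≤ Real.sqrt S := by
    refine L.opNorm_le_bound (Real.sqrt_nonneg _) fun v => ?_
    have hv : v = ∑ i : Fin N, v i • EuclideanSpace.single i (1 : ℝ) := by
      have := (EuclideanSpace.basisFun (Fin N) ℝ).sum_repr v
      simpa using this.symm
    have h1 : L v = ∑ i : Fin N, v i * L (EuclideanSpace.single i 1) := by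
      conv_lhs => rw [hv]
      rw [map_sum]
      refine Finset.sum_congr rfl fun i _ => ?_
      rw [map_smul, smul_eq_mul]
    have h2 := Finset.sum_mul_sq_le_sq_mul_sq Finset.univ (fun i => v i)
      (fun i => L (EuclideanSpace.single i 1))
    have h3 : ∑ i : Fin N, (v i) ^ 2 = ‖v‖ ^ 2 := by
      rw [EuclideanSpace.norm_sq_eq]; simp
    rw [← h1, h3, ← hS] at h2
    rw [Real.norm_eq_abs]
    refine abs_le_of_sq_le_sq ?_ (by positivity)
    rw [mul_pow, Real.sq_sqrt hS0]; linarith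
  calc ‖L‖ ^ 2 ≤ (Real.sqrt S) ^ 2 := by gcongr
    _ = S := Real.sq_sqrt hS0

lemma power_superharmonic {N : ℕ} {u : EuclideanSpace ℝ (Fin N) → ℝ}
    (hu : ContDiffOn ℝ 2 u (Metric.ball 0 1))
    (h0 : ∀ x ∈ Metric.ball (0 : EuclideanSpace ℝ (Fin N)) 1, 0 < u x)
    (hs : ∀ x ∈ Metric.ball (0 : EuclideanSpace ℝ (Fin N)) 1, laplacian u x ≤ 0)
    {s : ℝ} (hs0 : 0 < s) (hs1 : s < 1) :
    ContDiffOn ℝ 2 (fun x => u x ^ s) (Metric.ball 0 1) ∧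
    ∀ x ∈ Metric.ball (0 : EuclideanSpace ℝ (Fin N)) 1,
      u x ^ s * laplacian (fun x => u x ^ s) x +
        ((1 - s) / s) * ‖fderiv ℝ (fun x => u x ^ s) x‖ ^ 2 ≤ 0 := by
  refine ⟨hu.rpow_const_of_ne fun x hx => (h0 x hx).ne', ?_⟩
  intro x hx
  have hpos := h0 x hx
  have hfd : ∀ y ∈ Metric.ball (0 : EuclideanSpace ℝ (Fin N)) 1,
      HasFDerivAt (fun x => u x ^ s) ((s * u y ^ (s - 1)) • fderiv ℝ u y) y := by
    intro y hy
    have h1 := ((hu.contDiffAt (Metric.isOpen_ball.mem_nhds hy)).differentiableAt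
      (by norm_num)).hasFDerivAt
    exact h1.rpow_const (Or.inl (h0 y hy).ne')
  have hux := (hu.contDiffAt (Metric.isOpen_ball.mem_nhds hx))
  have hlap : laplacian (fun x => u x ^ s) x = s * u x ^ (s - 1) * laplacian u x +
      s * (s - 1) * u x ^ (s - 2) *
        ∑ i : Fin N, (fderiv ℝ u x (EuclideanSpace.single i 1)) ^ 2 := by
    unfold laplacian
    rw [Finset.mul_sum, Finset.mul_sum, ← Finset.sum_add_distrib]
    refine Finset.sum_congr rfl fun i _ => ?_
    have e : (fun y => fderiv ℝ (fun x => u x ^ s) y (EuclideanSpace.single i 1)) =ᶠ[𝓝 x]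
        fun y => (s * u y ^ (s - 1)) * fderiv ℝ u y (EuclideanSpace.single i 1) := by
      filter_upwards [Metric.isOpen_ball.mem_nhds hx] with y hy
      rw [(hfd y hy).fderiv]; simp
    rw [e.fderiv_eq]
    have h1 := (hux.differentiableAt (by norm_num)).hasFDerivAt
    have h2 := (h1.rpow_const (p := s - 1) (Or.inl hpos.ne')).const_mul s
    have h3 : HasFDerivAt (fun y => fderiv ℝ u y (EuclideanSpace.single i 1)) _ x :=
      (((hux.fderiv_right (m := 1) (by norm_num)).differentiableAt (by norm_num)).clm_apply
      (differentiableAt_const _)).hasFDerivAt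
    have h4 := (h2.mul h3).fderiv
    have h5 : ((fun y => s * u y ^ (s - 1)) * fun y => fderiv ℝ u y (EuclideanSpace.single i 1)) =
      fun y => (s * u y ^ (s - 1)) * fderiv ℝ u y (EuclideanSpace.single i 1) := rfl
    rw [h5] at h4
    rw [h4]
    simp only [add_apply, smul_apply, smul_eq_mul]
    have : s - 1 - 1 = s - 2 := by ring
    rw [this]
    ring
  rw [hlap, (hfd x hx).fderiv, norm_smul]
  set G := ∑ i : Fin N, (fderiv ℝ u x (EuclideanSpace.single i 1)) ^ 2 with hG
  have hGn : ‖fderiv ℝ u x‖ ^ 2 ≤ G := norm_sq_le_sum _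
  have hu1 : 0 < u x ^ (s - 1) := Real.rpow_pos_of_pos hpos _
  have hu0 : 0 < u x ^ s := Real.rpow_pos_of_pos hpos _
  have e1 : u x ^ s * u x ^ (s - 2) = (u x ^ (s - 1)) ^ 2 := by
    rw [← Real.rpow_add hpos, ← Real.rpow_natCast, ← Real.rpow_mul hpos.le]
    congr 1; push_cast; ring
  have h6 := hs x hx
  have e2 : u x ^ s * (s * u x ^ (s - 1) * laplacian u x + s * (s - 1) * u x ^ (s - 2) * G) +
      (1 - s) / s * (‖s * u x ^ (s - 1)‖ * ‖fderiv ℝ u x‖) ^ 2 =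
      s * u x ^ s * u x ^ (s - 1) * laplacian u x -
      s * (1 - s) * (u x ^ (s - 1)) ^ 2 * (G - ‖fderiv ℝ u x‖ ^ 2) := by
    rw [mul_pow, Real.norm_eq_abs, sq_abs, mul_pow, ← e1]
    field_simp
    ring
  rw [e2]
  have h7 : 0 ≤ s * (1 - s) * (u x ^ (s - 1)) ^ 2 * (G - ‖fderiv ℝ u x‖ ^ 2) := by
    have : 0 < 1 - s := by linarith
    have : 0 ≤ G - ‖fderiv ℝ u x‖ ^ 2 := by linarith
    positivity
  have h8 : s * u x ^ s * u x ^ (s - 1) * laplacian u x ≤ 0 :=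
    mul_nonpos_of_nonneg_of_nonpos (by positivity) h6
  linarith


/-- truncated power profile -/
noncomputable def gP (γ ε D : ℝ) : ℝ := max ((max D 0) ^ γ - ε) 0

/-- first profile -/
noncomputable def pE (γ ε D : ℝ) : ℝ := gP γ ε D ^ 3

/-- second profile -/
noncomputable def pPsi (γ ε D : ℝ) : ℝ := gP γ ε D ^ 2 * D ^ (γ - 1)

/-- derivative of the second profile -/
noncomputable def pPsi1 (γ ε D : ℝ) : ℝ :=
  2 * γ * gP γ ε D * (D ^ (γ - 1) * D ^ (γ - 1)) + gP γ ε D ^ 2 * ((γ - 1) * D ^ (γ - 2))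

lemma gP_continuous {γ : ℝ} (hγ : 0 < γ) (ε : ℝ) : Continuous (gP γ ε) := by
  unfold gP
  have : Continuous fun D : ℝ => (max D 0) ^ γ :=
    (Real.continuous_rpow_const hγ.le).comp (by fun_prop)
  fun_prop

lemma gP_zero_near {γ ε : ℝ} (hγ : 0 < γ) (hε : 0 < ε) {D : ℝ} (hD : D ≤ 0) :
    ∀ᶠ z in 𝓝 D, gP γ ε z = 0 := by
  have hc : Continuous fun D : ℝ => (max D 0) ^ γ :=
    (Real.continuous_rpow_const hγ.le).comp (by fun_prop)
  have h0 : (max D 0) ^ γ < ε := by rw [max_eq_right hD, Real.zero_rpow hγ.ne']; exact hε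
  filter_upwards [(hc.tendsto D).eventually (gt_mem_nhds h0)] with z hz
  unfold gP
  exact max_eq_right (by linarith)

lemma gP_pos_eq {γ ε : ℝ} {D : ℝ} (hD : 0 < D) :
    gP γ ε =ᶠ[𝓝 D] fun z => max (z ^ γ - ε) 0 := by
  filter_upwards [lt_mem_nhds hD] with z hz
  unfold gP
  rw [max_eq_left hz.le]

lemma hasDerivAt_gPpow {γ ε : ℝ} (n : ℕ) {D : ℝ} (hD : 0 < D) :
    HasDerivAt (fun z => gP γ ε z ^ (n + 2))
      ((n + 2) * gP γ ε D ^ (n + 1) * (γ * D ^ (γ - 1))) D := by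
  have h1 : HasDerivAt (fun z : ℝ => z ^ γ - ε) (γ * D ^ (γ - 1)) D :=
    (Real.hasDerivAt_rpow_const (Or.inl hD.ne')).sub_const ε
  have h2 := (hasDerivAt_pospow n (D ^ γ - ε)).comp D h1
  have e : (fun z => gP γ ε z ^ (n + 2)) =ᶠ[𝓝 D]
      (fun y : ℝ => (max y 0) ^ (n + 2)) ∘ (fun z : ℝ => z ^ γ - ε) := by
    filter_upwards [gP_pos_eq (γ := γ) (ε := ε) hD] with z hz
    rw [hz]; rfl
  rw [(gP_pos_eq (γ := γ) (ε := ε) hD).self_of_nhds]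
  exact h2.congr_of_eventuallyEq e

lemma hasDerivAt_pE {γ ε : ℝ} (hγ : 0 < γ) (hε : 0 < ε) (D : ℝ) :
    HasDerivAt (pE γ ε) (3 * γ * pPsi γ ε D) D := by
  rcases lt_or_ge 0 D with hD | hD
  · have := hasDerivAt_gPpow (γ := γ) (ε := ε) 1 hD
    refine HasDerivAt.congr_deriv this ?_
    unfold pPsi; push_cast; ring
  · have h := gP_zero_near hγ hε hD
    have e : pE γ ε =ᶠ[𝓝 D] fun _ => 0 := by
      filter_upwards [h] with z hz
      simp [pE, hz]
    have : pPsi γ ε D = 0 := by simp [pPsi, h.self_of_nhds]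
    rw [this, mul_zero]
    exact (hasDerivAt_const D (0 : ℝ)).congr_of_eventuallyEq e

lemma hasDerivAt_pPsi {γ ε : ℝ} (hγ : 0 < γ) (hε : 0 < ε) (D : ℝ) :
    HasDerivAt (pPsi γ ε) (pPsi1 γ ε D) D := by
  rcases lt_or_ge 0 D with hD | hD
  · have h1 := hasDerivAt_gPpow (γ := γ) (ε := ε) 0 hD
    have h2 : HasDerivAt (fun z : ℝ => z ^ (γ - 1)) ((γ - 1) * D ^ (γ - 1 - 1)) D :=
      Real.hasDerivAt_rpow_const (Or.inl hD.ne')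
    refine HasDerivAt.congr_deriv (h1.mul h2) ?_
    have : γ - 1 - 1 = γ - 2 := by ring
    rw [this]
    unfold pPsi1; push_cast; ring
  · have h := gP_zero_near hγ hε hD
    have e : pPsi γ ε =ᶠ[𝓝 D] fun _ => 0 := by
      filter_upwards [h] with z hz
      simp [pPsi, hz]
    have : pPsi1 γ ε D = 0 := by simp [pPsi1, h.self_of_nhds]
    rw [this]
    exact (hasDerivAt_const D (0 : ℝ)).congr_of_eventuallyEq e

lemma continuous_pPsi1 {γ ε : ℝ} (hγ : 0 < γ) (hε : 0 < ε) : Continuous (pPsi1 γ ε) := by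
  rw [continuous_iff_continuousAt]
  intro D
  rcases lt_or_ge 0 D with hD | hD
  · have h1 := (gP_continuous hγ ε).continuousAt (x := D)
    have h2 : ∀ p : ℝ, ContinuousAt (fun z : ℝ => z ^ p) D := fun p =>
      Real.continuousAt_rpow_const _ _ (Or.inl hD.ne')
    unfold pPsi1
    exact ((continuousAt_const.mul h1).mul ((h2 _).mul (h2 _))).add
      ((h1.pow 2).mul (continuousAt_const.mul (h2 _)))
  · have h := gP_zero_near hγ hε hD
    have e : pPsi1 γ ε =ᶠ[𝓝 D] fun _ => 0 := by
      filter_upwards [h] with z hz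
      simp [pPsi1, hz]
    exact continuousAt_const.congr e.symm

lemma contDiff_pPsi {γ ε : ℝ} (hγ : 0 < γ) (hε : 0 < ε) : ContDiff ℝ 1 (pPsi γ ε) := by
  rw [contDiff_one_iff_deriv]
  refine ⟨fun D => (hasDerivAt_pPsi hγ hε D).differentiableAt, ?_⟩
  have : deriv (pPsi γ ε) = pPsi1 γ ε := by
    funext D; exact (hasDerivAt_pPsi hγ hε D).deriv
  rw [this]; exact continuous_pPsi1 hγ hε

lemma contDiff_pE {γ ε : ℝ} (hγ : 0 < γ) (hε : 0 < ε) : ContDiff ℝ 2 (pE γ ε) := by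
  have : (2 : WithTop ℕ∞) = 1 + 1 := by norm_num
  rw [this, contDiff_succ_iff_deriv]
  refine ⟨fun D => (hasDerivAt_pE hγ hε D).differentiableAt, by simp, ?_⟩
  have : deriv (pE γ ε) = fun D => 3 * γ * pPsi γ ε D := by
    funext D; exact (hasDerivAt_pE hγ hε D).deriv
  rw [this]; exact contDiff_const.mul (contDiff_pPsi hγ hε)

/-- algebraic inequalities for the profiles -/
lemma profile_ineq {κ ε : ℝ} (hκ : 0 < κ) (hκ1 : κ < 1) (hε : 0 < ε) {D : ℝ} (hD : 0 < D)
    (hD1 : D ≤ 1) :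
    ∃ h : ℝ, 0 ≤ h ∧ κ * h ≤ pPsi1 ((1 + κ) / 3) ε D ∧ pPsi ((1 + κ) / 3) ε D ≤ D * h ∧
      |pPsi1 ((1 + κ) / 3) ε D| ≤ 2 * h ∧
      pPsi ((1 + κ) / 3) ε D ^ 2 = pE ((1 + κ) / 3) ε D * h ∧ D * h ≤ 1 := by
  set γ := (1 + κ) / 3 with hγ
  set P := D ^ γ with hP
  have hPpos : 0 < P := Real.rpow_pos_of_pos hD _
  have e1 : D ^ (γ - 1) = P / D := by rw [Real.rpow_sub_one hD.ne']
  have e2 : D ^ (γ - 2) = P / D ^ 2 := by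
    rw [Real.rpow_sub hD, ← hP]; norm_num
  set g := gP γ ε D with hg
  have hgeq : g = max (P - ε) 0 := by rw [hg, gP, max_eq_left hD.le]
  have hg0 : 0 ≤ g := by rw [hgeq]; exact le_max_right _ _
  have hgP : g ≤ P := by rw [hgeq]; exact max_le (by linarith) hPpos.le
  have hP3 : P ^ 3 = D ^ κ * D := by
    rw [hP, ← Real.rpow_natCast, ← Real.rpow_mul hD.le, ← Real.rpow_add_one hD.ne']
    congr 1; rw [hγ]; push_cast; ring
  have hDκ : D ^ κ ≤ 1 := Real.rpow_le_one hD.le hD1 hκ.le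
  have hγ1 : γ < 1 := by rw [hγ]; linarith
  have hγ0 : 0 < γ := by rw [hγ]; linarith
  have hψ1 : pPsi1 γ ε D = (2 * γ * (g * P) - (1 - γ) * (g * g)) * (P / D ^ 2) := by
    unfold pPsi1; rw [e1, e2, ← hg]; field_simp; ring
  have hψ : pPsi γ ε D = g ^ 2 * (P / D) := by unfold pPsi; rw [e1]
  refine ⟨g * P * (P / D ^ 2), by positivity, ?_, ?_, ?_, ?_, ?_⟩
  · rw [hψ1, ← mul_assoc]
    refine mul_le_mul_of_nonneg_right ?_ (by positivity)
    have : κ = 3 * γ - 1 := by rw [hγ]; ring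
    rw [this]
    have : 0 ≤ (1 - γ) * (g * (P - g)) :=
      mul_nonneg (by linarith) (mul_nonneg hg0 (by linarith))
    nlinarith
  · rw [hψ]
    have : D * (g * P * (P / D ^ 2)) = g * P * (P / D) := by field_simp
    rw [this]
    refine mul_le_mul_of_nonneg_right ?_ (by positivity)
    nlinarith
  · rw [hψ1, abs_mul, abs_of_nonneg (by positivity : (0 : ℝ) ≤ P / D ^ 2),
      show 2 * (g * P * (P / D ^ 2)) = (2 * (g * P)) * (P / D ^ 2) by ring]
    refine mul_le_mul_of_nonneg_right ?_ (by positivity)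
    have h1 : 0 ≤ g * P := by positivity
    have h2 : g * g ≤ g * P := by nlinarith
    have h3 : 0 ≤ g * g := by positivity
    rw [abs_le]
    constructor
    · nlinarith [mul_nonneg hγ0.le h1, mul_nonneg hγ0.le h3]
    · nlinarith [mul_nonneg (by linarith : (0 : ℝ) ≤ 1 - γ) h3]
  · rw [hψ, pE, ← hg]; field_simp
  · have : D * (g * P * (P / D ^ 2)) = g * P ^ 2 / D := by field_simp
    rw [this, div_le_one hD]
    calc g * P ^ 2 ≤ P * P ^ 2 := by gcongr
      _ = D ^ κ * D := by rw [← hP3]; ring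
      _ ≤ 1 * D := by gcongr
      _ = D := one_mul D

lemma profile_lower {κ ε : ℝ} {D : ℝ} (hD : 0 < D)
    (hDε : 2 * ε ≤ D ^ ((1 + κ) / 3)) : D ^ κ ≤ 4 * pPsi ((1 + κ) / 3) ε D := by
  set γ := (1 + κ) / 3 with hγ
  set P := D ^ γ with hP
  have hPpos : 0 < P := Real.rpow_pos_of_pos hD _
  have e1 : D ^ (γ - 1) = P / D := by rw [Real.rpow_sub_one hD.ne']
  have hP3 : P ^ 3 = D ^ κ * D := by
    rw [hP, ← Real.rpow_natCast, ← Real.rpow_mul hD.le, ← Real.rpow_add_one hD.ne']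
    congr 1; rw [hγ]; push_cast; ring
  have hg : P / 2 ≤ gP γ ε D := by
    rw [gP, max_eq_left hD.le]; exact le_max_of_le_left (by linarith)
  have h1 : D ^ κ = 4 * ((P / 2) ^ 2 * (P / D)) := by
    field_simp; linarith
  rw [h1]; unfold pPsi; rw [e1]; gcongr


set_option maxHeartbeats 2000000 in
lemma energy {N : ℕ} {κ : ℝ} (hκ : 0 < κ) (hκ1 : κ < 1) {c : ℝ} (hc : 0 < c) {ρ : ℝ}
    (hρ0 : 0 < ρ) (hρ1 : ρ < 1) (hρ : 1 - ρ ^ 2 ≤ κ / (2 * κ + N)) :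
    ∃ A > (0 : ℝ), ∀ V : EuclideanSpace ℝ (Fin N) → ℝ,
      ContDiffOn ℝ 2 V (Metric.ball (0 : EuclideanSpace ℝ (Fin N)) 1) →
      (∀ x ∈ Metric.ball (0 : EuclideanSpace ℝ (Fin N)) 1, 0 < V x) →
      (∀ x ∈ Metric.ball (0 : EuclideanSpace ℝ (Fin N)) 1,
        V x * laplacian V x + c * ‖fderiv ℝ V x‖ ^ 2 ≤ 0) →
      ∀ ε : ℝ, 0 < ε → ε < 1 → ∃ W : EuclideanSpace ℝ (Fin N) → ℝ, ContDiff ℝ 1 W ∧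
        HasCompactSupport W ∧
        (∀ x ∈ Metric.ball (0 : EuclideanSpace ℝ (Fin N)) 1,
          W x = V x * pPsi ((1 + κ) / 3) ε (1 - ‖x‖ ^ 2)) ∧
        ∫ x, ‖fderiv ℝ W x‖ ≤
          A * ∫ x in Metric.closedBall (0 : EuclideanSpace ℝ (Fin N)) ρ, V x := by
  set γ := (1 + κ) / 3 with hγ
  have hγ0 : 0 < γ := by rw [hγ]; linarith
  set C0 : ℝ := 6 * γ * (2 * κ + N) with hC0
  have hC0pos : 0 < C0 := by positivity
  set A : ℝ := 1 / c + 5 / (6 * γ * κ) with hA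
  have hApos : 0 < A := by positivity
  refine ⟨A * C0, by positivity, ?_⟩
  intro V hV hVpos hVs ε hε hε1
  -- support radius
  set d0 : ℝ := ε ^ (1 / γ) with hd0
  have hd0pos : 0 < d0 := Real.rpow_pos_of_pos hε _
  have hd01 : d0 < 1 := Real.rpow_lt_one hε.le hε1 (by positivity)
  have hgz : ∀ D, D ≤ d0 → gP γ ε D = 0 := by
    intro D hD
    have h1 : (max D 0) ^ γ ≤ ε := by
      calc (max D 0) ^ γ ≤ d0 ^ γ :=
            Real.rpow_le_rpow (le_max_right _ _) (max_le hD hd0pos.le) hγ0.le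
        _ = ε := by rw [hd0, ← Real.rpow_mul hε.le]; field_simp; simp
    unfold gP
    exact max_eq_right (by linarith)
  set r0 : ℝ := Real.sqrt (1 - d0) with hr0
  have hr00 : 0 ≤ r0 := Real.sqrt_nonneg _
  have hr0sq : r0 ^ 2 = 1 - d0 := Real.sq_sqrt (by linarith)
  have hr01 : r0 < 1 := by nlinarith
  set m : ℝ := max r0 ρ with hm
  have hm1 : m < 1 := max_lt hr01 hρ1
  have hmr0 : r0 ≤ m := le_max_left _ _
  have hmρ : ρ ≤ m := le_max_right _ _
  set r : ℝ := (1 + m) / 2 with hr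
  have hr1 : r < 1 := by rw [hr]; linarith
  have hmr : m < r := by rw [hr]; linarith
  have hgz' : ∀ x : EuclideanSpace ℝ (Fin N), r0 ≤ ‖x‖ → gP γ ε (1 - ‖x‖ ^ 2) = 0 := by
    intro x hx
    apply hgz; nlinarith
  obtain ⟨U, hU, hUV⟩ := cutoff_ext hV (r := r) (by linarith) hr1
  have hsub : Metric.ball (0 : EuclideanSpace ℝ (Fin N)) r ⊆ Metric.ball 0 1 :=
    Metric.ball_subset_ball hr1.le
  have hUpos : ∀ x ∈ Metric.ball (0 : EuclideanSpace ℝ (Fin N)) r, 0 < U x := by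
    intro x hx; rw [hUV x hx]; exact hVpos x (hsub hx)
  have hUs : ∀ x ∈ Metric.ball (0 : EuclideanSpace ℝ (Fin N)) r,
      U x * laplacian U x + c * ‖fderiv ℝ U x‖ ^ 2 ≤ 0 := by
    intro x hx
    have : U =ᶠ[𝓝 x] V := by
      filter_upwards [Metric.isOpen_ball.mem_nhds hx] with z hz using hUV z hz
    rw [laplacian_congr this, this.fderiv_eq, hUV x hx]
    exact hVs x (hsub hx)
  -- test functions
  have hDc : ∀ n : WithTop ℕ∞, ContDiff ℝ n (fun x : EuclideanSpace ℝ (Fin N) => 1 - ‖x‖ ^ 2) :=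
    fun n => contDiff_const.sub (contDiff_norm_sq ℝ)
  let η : EuclideanSpace ℝ (Fin N) → ℝ := fun x => pE γ ε (1 - ‖x‖ ^ 2)
  let ψ : EuclideanSpace ℝ (Fin N) → ℝ := fun x => pPsi γ ε (1 - ‖x‖ ^ 2)
  have hη : ContDiff ℝ 2 η := (contDiff_pE hγ0 hε).comp (hDc 2)
  have hψ : ContDiff ℝ 1 ψ := (contDiff_pPsi hγ0 hε).comp (hDc 1)
  have hηs : HasCompactSupport η := by
    refine HasCompactSupport.intro (isCompact_closedBall (0 : EuclideanSpace ℝ (Fin N)) r0) ?_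
    intro x hx
    have : r0 < ‖x‖ := by simpa using hx
    simp [η, pE, hgz' x this.le]
  have hψs : HasCompactSupport ψ := by
    refine HasCompactSupport.intro (isCompact_closedBall (0 : EuclideanSpace ℝ (Fin N)) r0) ?_
    intro x hx
    have : r0 < ‖x‖ := by simpa using hx
    simp [ψ, pPsi, hgz' x this.le]
  have hsubd : ∀ t : ℝ, HasDerivAt (fun t : ℝ => 1 - t) (-1) t := fun t =>
    (hasDerivAt_id t).const_sub 1
  have hlapη : ∀ x, laplacian η x = 4 * ‖x‖ ^ 2 * (3 * γ * pPsi1 γ ε (1 - ‖x‖ ^ 2)) -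
      2 * N * (3 * γ * pPsi γ ε (1 - ‖x‖ ^ 2)) := by
    intro x
    have h1 : ∀ t, HasDerivAt (fun t => pE γ ε (1 - t)) (-(3 * γ * pPsi γ ε (1 - t))) t := by
      intro t
      refine HasDerivAt.congr_deriv ((hasDerivAt_pE hγ0 hε (1 - t)).comp t (hsubd t)) ?_
      ring
    have h2 : ∀ t, HasDerivAt (fun t => -(3 * γ * pPsi γ ε (1 - t)))
        (3 * γ * pPsi1 γ ε (1 - t)) t := by
      intro t
      refine HasDerivAt.congr_deriv
        ((((hasDerivAt_pPsi hγ0 hε (1 - t)).comp t (hsubd t)).const_mul (3 * γ)).neg) ?_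
      ring
    have := laplacian_radial h1 h2 x
    rw [this]; ring
  have hfdψ : ∀ x, ‖fderiv ℝ ψ x‖ ≤ |pPsi1 γ ε (1 - ‖x‖ ^ 2)| * (2 * ‖x‖) := by
    intro x
    have h1 : HasDerivAt (fun t => pPsi γ ε (1 - t)) (-pPsi1 γ ε (1 - ‖x‖ ^ 2)) (‖x‖ ^ 2) := by
      refine HasDerivAt.congr_deriv
        ((hasDerivAt_pPsi hγ0 hε (1 - ‖x‖ ^ 2)).comp (‖x‖ ^ 2) (hsubd _)) ?_
      ring
    have := (hasFDerivAt_radial x h1).fderiv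
    rw [this, norm_smul, norm_smul, innerSL_apply_norm]
    simp
  let W : EuclideanSpace ℝ (Fin N) → ℝ := fun x => U x * ψ x
  have hW : ContDiff ℝ 1 W := (hU.of_le (by norm_num)).mul hψ
  have hWs : HasCompactSupport W := hψs.mul_left
  have hfdW : ∀ x, ‖fderiv ℝ W x‖ ≤ |U x| * ‖fderiv ℝ ψ x‖ + |ψ x| * ‖fderiv ℝ U x‖ := by
    intro x
    have : fderiv ℝ W x = U x • fderiv ℝ ψ x + ψ x • fderiv ℝ U x :=
      fderiv_fun_mul (hU.differentiable (by norm_num) x) (hψ.differentiable (by norm_num) x)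
    rw [this]
    refine (norm_add_le _ _).trans ?_
    rw [norm_smul, norm_smul, Real.norm_eq_abs, Real.norm_eq_abs]
  refine ⟨W, hW, hWs, ?_, ?_⟩
  · intro x hx
    by_cases hxr : x ∈ Metric.ball (0 : EuclideanSpace ℝ (Fin N)) r
    · simp only [W, ψ]; rw [hUV x hxr]
    · have hxn : r ≤ ‖x‖ := by simpa using hxr
      have : pPsi γ ε (1 - ‖x‖ ^ 2) = 0 := by
        simp [pPsi, hgz' x (by linarith)]
      simp only [W, ψ]; rw [this]; simp
  -- pointwise inequality
  set K : Set (EuclideanSpace ℝ (Fin N)) := Metric.closedBall 0 ρ with hK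
  have hKr : K ⊆ Metric.ball (0 : EuclideanSpace ℝ (Fin N)) r :=
    Metric.closedBall_subset_ball (by linarith)
  have hind : ∀ x, 0 ≤ K.indicator U x := fun x =>
    indicator_nonneg (fun y hy => (hUpos y (hKr hy)).le) x
  have hpt : ∀ x, ‖fderiv ℝ W x‖ ≤
      A * (U x * laplacian η x + C0 * K.indicator U x - laplacian U x * η x) := by
    intro x
    by_cases hx : r0 ≤ ‖x‖
    · have hz := hgz' x hx
      have z1 : pPsi1 γ ε (1 - ‖x‖ ^ 2) = 0 := by simp [pPsi1, hz]
      have z2 : pPsi γ ε (1 - ‖x‖ ^ 2) = 0 := by simp [pPsi, hz]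
      have z3 : η x = 0 := by simp [η, pE, hz]
      have z4 : ψ x = 0 := z2
      have h1 := hfdW x
      have h2 := hfdψ x
      rw [z1, abs_zero, zero_mul] at h2
      have h3 : ‖fderiv ℝ ψ x‖ = 0 := le_antisymm h2 (norm_nonneg _)
      rw [h3, z4, abs_zero, zero_mul, mul_zero, add_zero] at h1
      rw [hlapη, z1, z2, z3]
      have := hind x
      have : 0 ≤ A * (C0 * K.indicator U x) := by positivity
      refine h1.trans ?_
      simpa using this
    · push Not at hx
      have hxr : x ∈ Metric.ball (0 : EuclideanSpace ℝ (Fin N)) r := by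
        simp only [Metric.mem_ball, dist_zero_right]; linarith
      have hx0 := norm_nonneg x
      set D : ℝ := 1 - ‖x‖ ^ 2 with hD
      have hDpos : 0 < D := by rw [hD]; nlinarith
      have hD1 : D ≤ 1 := by rw [hD]; nlinarith
      obtain ⟨h, hh0, i1, i2, i3, i4, i5⟩ := profile_ineq hκ hκ1 hε hDpos hD1
      rw [← hγ] at i1 i2 i3 i4
      have hu := hUpos x hxr
      have hus := hUs x hxr
      set a := ‖fderiv ℝ U x‖ with ha
      have ha0 : 0 ≤ a := norm_nonneg _
      have hηx : η x = pE γ ε D := rfl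
      have hψx : ψ x = pPsi γ ε D := rfl
      have hE0 : 0 ≤ pE γ ε D := by
        unfold pE gP; positivity
      have hψ0 : 0 ≤ pPsi γ ε D := by
        unfold pPsi; have := Real.rpow_nonneg hDpos.le (γ - 1); positivity
      -- gradient bound
      have g1 : ‖fderiv ℝ ψ x‖ ≤ 4 * h := by
        refine (hfdψ x).trans ?_
        rw [← hD]
        calc |pPsi1 γ ε D| * (2 * ‖x‖) ≤ (2 * h) * (2 * 1) := by gcongr; linarith
          _ = 4 * h := by ring
      have hlap : a ^ 2 / U x ≤ - laplacian U x / c := by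
        rw [div_le_div_iff₀ hu hc]; linarith
      have g2 : pPsi γ ε D * a ≤ pE γ ε D * (- laplacian U x / c) + U x * h := by
        have h1 : pPsi γ ε D * a ≤ pE γ ε D * (a ^ 2 / U x) + U x * h := by
          have hb : 0 ≤ pE γ ε D * (a ^ 2 / U x) + U x * h := by positivity
          refine (sq_le_sq₀ (by positivity) hb).1 ?_
          have e : pE γ ε D * (a ^ 2 / U x) * (U x * h) = (pPsi γ ε D * a) ^ 2 := by
            rw [mul_pow, i4]; field_simp
          nlinarith [sq_nonneg (pE γ ε D * (a ^ 2 / U x)), sq_nonneg (U x * h),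
            sq_nonneg (pPsi γ ε D * a)]
        have h2 : pE γ ε D * (a ^ 2 / U x) ≤ pE γ ε D * (- laplacian U x / c) := by gcongr
        linarith
      have g3 : ‖fderiv ℝ W x‖ ≤ 5 * (U x * h) + (1 / c) * (- laplacian U x * η x) := by
        have h1 := hfdW x
        rw [abs_of_pos hu, hψx, abs_of_nonneg hψ0] at h1
        have h2 : U x * ‖fderiv ℝ ψ x‖ ≤ U x * (4 * h) := by gcongr
        have h3 : pE γ ε D * (- laplacian U x / c) = (1 / c) * (- laplacian U x * η x) := by
          rw [hηx]; ring
        rw [h3] at g2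
        linarith
      -- laplacian of eta
      have g4 : 6 * γ * κ * (U x * h) ≤ U x * laplacian η x + C0 * K.indicator U x := by
        have h1 : 6 * γ * (2 * κ * h * (1 - D) - N * (D * h)) ≤ laplacian η x := by
          rw [hlapη, ← hD]
          have e : ‖x‖ ^ 2 = 1 - D := by rw [hD]; ring
          rw [e]
          have t1 : γ * (1 - D) * (κ * h) ≤ γ * (1 - D) * pPsi1 γ ε D :=
            mul_le_mul_of_nonneg_left i1 (mul_nonneg hγ0.le (by linarith))
          have t2 : N * γ * pPsi γ ε D ≤ N * γ * (D * h) :=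
            mul_le_mul_of_nonneg_left i2 (by positivity)
          linarith
        by_cases hxK : x ∈ K
        · rw [indicator_of_mem hxK]
          have h2 : 6 * γ * κ * h ≤ laplacian η x + C0 := by
            refine le_trans ?_ (add_le_add_left h1 C0)
            have t1 : (2 * κ + N) * (D * h) ≤ (2 * κ + N) * 1 := by gcongr
            have t2 : 0 ≤ κ * h := by positivity
            rw [hC0]
            have : 6 * γ * (2 * κ * h * (1 - D) - N * (D * h)) + 6 * γ * (2 * κ + N) -
              6 * γ * κ * h = 6 * γ * (κ * h + ((2 * κ + N) * 1 - (2 * κ + N) * (D * h))) := by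
              ring
            have : 0 ≤ 6 * γ * (κ * h + ((2 * κ + N) * 1 - (2 * κ + N) * (D * h))) :=
              mul_nonneg (by positivity) (by linarith)
            linarith
          have := mul_le_mul_of_nonneg_left h2 hu.le
          linarith
        · rw [indicator_of_notMem hxK]
          have hxρ : ρ < ‖x‖ := by simpa [hK] using hxK
          have hDδ : D ≤ κ / (2 * κ + N) := by
            refine le_trans ?_ hρ
            rw [hD]; nlinarith
          rw [le_div_iff₀ (by positivity)] at hDδ
          have h2 : 6 * γ * κ * h ≤ laplacian η x := by
            refine le_trans ?_ h1
            have : 6 * γ * (2 * κ * h * (1 - D) - N * (D * h)) - 6 * γ * κ * h =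
              6 * γ * h * (κ - D * (2 * κ + N)) := by ring
            have : 0 ≤ 6 * γ * h * (κ - D * (2 * κ + N)) :=
              mul_nonneg (by positivity) (by linarith)
            linarith
          have := mul_le_mul_of_nonneg_left h2 hu.le
          linarith
      -- combine
      have hXpos : 0 ≤ U x * h := by positivity
      have hYpos : 0 ≤ - laplacian U x * η x := by
        refine mul_nonneg ?_ (by rw [hηx]; exact hE0)
        have : U x * laplacian U x ≤ 0 := by nlinarith [sq_nonneg a]
        by_contra! hcon
        nlinarith
      set Z := U x * laplacian η x + C0 * K.indicator U x with hZ
      have hZ0 : 0 ≤ Z := le_trans (by positivity) g4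
      have t1 : 5 * (U x * h) ≤ 5 / (6 * γ * κ) * Z := by
        rw [div_mul_eq_mul_div, le_div_iff₀ (by positivity)]
        linarith
      have t2 : 0 ≤ (1 / c) * Z := by positivity
      have t3 : 0 ≤ 5 / (6 * γ * κ) * (- laplacian U x * η x) := by positivity
      refine g3.trans ?_
      have : A * (Z - laplacian U x * η x) = 5 / (6 * γ * κ) * Z + (1 / c) * Z +
        5 / (6 * γ * κ) * (- laplacian U x * η x) + (1 / c) * (- laplacian U x * η x) := by
        rw [hA]; ring
      rw [this]
      linarith
  have hUc := hU.continuous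
  have int1 : Integrable (fun x => U x * laplacian η x) :=
    (hUc.mul (continuous_laplacian hη)).integrable_of_hasCompactSupport
      (hcs_laplacian hηs).mul_left
  have int2 : Integrable (fun x => laplacian U x * η x) :=
    ((continuous_laplacian hU).mul hη.continuous).integrable_of_hasCompactSupport hηs.mul_left
  have int3 : Integrable (fun x => C0 * K.indicator U x) := by
    refine Integrable.const_mul ?_ _
    rw [integrable_indicator_iff measurableSet_closedBall]
    exact hUc.continuousOn.integrableOn_compact (isCompact_closedBall _ _)
  have hgreen := green hU hη hηs
  calc ∫ x, ‖fderiv ℝ W x‖ ≤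
      ∫ x, A * (U x * laplacian η x + C0 * K.indicator U x - laplacian U x * η x) := by
        refine integral_mono ?_ (((int1.add int3).sub int2).const_mul A) hpt
        refine Integrable.norm ?_
        exact (hW.continuous_fderiv (by norm_num)).integrable_of_hasCompactSupport
          (hWs.fderiv (𝕜 := ℝ))
    _ = A * (C0 * ∫ x in K, U x) := by
        rw [integral_const_mul]
        have e1 : ∫ x, (U x * laplacian η x + C0 * K.indicator U x - laplacian U x * η x) =
          (∫ x, U x * laplacian η x) + (∫ x, C0 * K.indicator U x) -
            ∫ x, laplacian U x * η x := by
          rw [← integral_add int1 int3]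
          exact integral_sub (int1.add int3) int2
        rw [e1, hgreen, integral_const_mul, integral_indicator measurableSet_closedBall]
        ring
    _ = A * C0 * ∫ x in K, V x := by
        rw [setIntegral_congr_fun measurableSet_closedBall (fun x hx => hUV x (hKr hx))]
        ring


lemma sobolev {N : ℕ} (hN : 2 ≤ N) :
    ∃ M : ENNReal, M ≠ ⊤ ∧ ∀ W : EuclideanSpace ℝ (Fin N) → ℝ, ContDiff ℝ 1 W →
      HasCompactSupport W →
      ∫⁻ x, ‖W x‖ₑ ^ ((N : ℝ) / (N - 1)) ≤
        (M * ENNReal.ofReal (∫ x, ‖fderiv ℝ W x‖)) ^ ((N : ℝ) / (N - 1)) := by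
  have hN' : (2 : ℝ) ≤ N := by exact_mod_cast hN
  have hp0 : 0 < (N : ℝ) / (N - 1) := div_pos (by linarith) (by linarith)
  set p : NNReal := ⟨(N : ℝ) / (N - 1), hp0.le⟩ with hp
  have hpc : (p : ℝ) = (N : ℝ) / (N - 1) := rfl
  have hconj : NNReal.HolderConjugate (Module.finrank ℝ (EuclideanSpace ℝ (Fin N))) p := by
    rw [finrank_euclideanSpace_fin, ← NNReal.holderConjugate_coe_iff, hpc]
    push_cast
    rw [Real.holderConjugate_iff]
    refine ⟨by linarith, ?_⟩
    have : (N : ℝ) ≠ 0 := by linarith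
    have : (N : ℝ) - 1 ≠ 0 := by linarith
    field_simp
    ring
  refine ⟨(eLpNormLESNormFDerivOneConst
    (volume : Measure (EuclideanSpace ℝ (Fin N))) (p : ℝ) : NNReal), ENNReal.coe_ne_top, fun W hW hWs => ?_⟩
  have h := eLpNorm_le_eLpNorm_fderiv_one (volume : Measure (EuclideanSpace ℝ (Fin N))) hW hWs hconj
  have hi : Integrable (fderiv ℝ W) := (hW.continuous_fderiv (by norm_num)).integrable_of_hasCompactSupport
          (hWs.fderiv (𝕜 := ℝ))
  rw [eLpNorm_one_eq_lintegral_enorm] at h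
  rw [ofReal_integral_norm_eq_lintegral_enorm hi]
  have h2 := ENNReal.rpow_le_rpow h hp0.le
  rw [← hpc, eLpNorm_nnreal_pow_eq_lintegral hconj.symm.pos.ne'] at h2
  exact h2

lemma weight_fin {N : ℕ} (hN : 2 ≤ N) :
    ∫⁻ x in Metric.ball (0 : EuclideanSpace ℝ (Fin N)) 1,
      ENNReal.ofReal ((1 - ‖x‖ ^ 2) ^ (-(1 / 2) : ℝ)) ≠ ⊤ := by
  have : Nontrivial (EuclideanSpace ℝ (Fin N)) := by
    apply Module.nontrivial_of_finrank_pos (R := ℝ); rw [finrank_euclideanSpace_fin]; omega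
  have h1 : IntegrableOn (fun y : ℝ => (1 - y) ^ (-(1 / 2) : ℝ)) (Ioo 0 1) := by
    have := (intervalIntegral.intervalIntegrable_rpow' (a := 0) (b := 1)
      (r := (-(1 / 2) : ℝ)) (by norm_num)).comp_sub_left 1
    simp only [sub_zero, sub_self] at this
    have h2 := this.symm.1
    exact h2.mono_set Ioo_subset_Ioc_self
  have h2 : IntegrableOn (fun x : EuclideanSpace ℝ (Fin N) => (1 - ‖x‖) ^ (-(1 / 2) : ℝ))
      (Metric.ball 0 1) := by
    rw [integrableOn_fun_norm_addHaar (volume : Measure (EuclideanSpace ℝ (Fin N)))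
      (f := fun y => (1 - y) ^ (-(1 / 2) : ℝ))]
    refine Integrable.mono h1 (by fun_prop) ?_
    filter_upwards [ae_restrict_mem measurableSet_Ioo] with y hy
    rw [norm_smul]
    refine mul_le_of_le_one_left (norm_nonneg _) ?_
    rw [norm_pow, Real.norm_eq_abs, abs_of_pos hy.1]
    exact pow_le_one₀ hy.1.le hy.2.le
  refine ne_top_of_le_ne_top h2.2.ne ?_
  refine setLIntegral_mono' measurableSet_ball ?_
  intro x hx
  have hx1 : ‖x‖ < 1 := by simpa using hx
  have hx0 := norm_nonneg x
  rw [← ofReal_norm]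
  refine ENNReal.ofReal_le_ofReal ?_
  refine le_trans ?_ (le_abs_self _)
  exact Real.rpow_le_rpow_of_nonpos (by linarith) (by nlinarith) (by norm_num)

lemma pointwise_split {q q2 t D : ℝ} (hq : 0 < q) (hq2 : q < q2) (ht : 0 < t) (hD : 0 < D) :
    t ^ q ≤ D ^ (-(1 / 2) : ℝ) + t ^ q2 * D ^ ((q2 - q) / (2 * q)) := by
  have hA : 0 ≤ D ^ (-(1 / 2) : ℝ) := Real.rpow_nonneg hD.le _
  by_cases h : t ^ q ≤ D ^ (-(1 / 2) : ℝ)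
  · have : 0 ≤ t ^ q2 * D ^ ((q2 - q) / (2 * q)) := by positivity
    linarith
  · push Not at h
    have hr : 0 ≤ (q2 - q) / q := div_nonneg (by linarith) hq.le
    have h1 := Real.rpow_le_rpow hA h.le hr
    rw [← Real.rpow_mul hD.le, ← Real.rpow_mul ht.le] at h1
    have e1 : q * ((q2 - q) / q) = q2 - q := by field_simp
    have e2 : -(1 / 2) * ((q2 - q) / q) = - ((q2 - q) / (2 * q)) := by field_simp
    rw [e1, e2] at h1
    have h2 : t ^ q2 = t ^ q * t ^ (q2 - q) := by rw [← Real.rpow_add ht]; congr 1; ring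
    have h3 : 1 ≤ t ^ (q2 - q) * D ^ ((q2 - q) / (2 * q)) := by
      calc (1 : ℝ) = D ^ (-((q2 - q) / (2 * q))) * D ^ ((q2 - q) / (2 * q)) := by
            rw [← Real.rpow_add hD]; simp
        _ ≤ _ := by gcongr
    have h4 : 0 ≤ t ^ q := Real.rpow_nonneg ht.le _
    rw [h2, mul_assoc]
    nlinarith


lemma core {N : ℕ} (hN : 2 ≤ N) (q : ℝ) (hq1 : 1 ≤ q) (hq2 : q < N / (N - 1)) :
    ∃ ρ : ℝ, 0 < ρ ∧ ρ < 1 ∧ ∃ K : ENNReal, K ≠ ⊤ ∧ ∀ u : EuclideanSpace ℝ (Fin N) → ℝ,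
      ContDiffOn ℝ 2 u (Metric.ball (0 : EuclideanSpace ℝ (Fin N)) 1) →
      (∀ x ∈ Metric.ball (0 : EuclideanSpace ℝ (Fin N)) 1, 0 < u x) →
      (∀ x ∈ Metric.ball (0 : EuclideanSpace ℝ (Fin N)) 1, laplacian u x ≤ 0) →
      (∫ x in Metric.closedBall (0 : EuclideanSpace ℝ (Fin N)) ρ, u x) ≤ 1 →
      ∫⁻ x in Metric.ball (0 : EuclideanSpace ℝ (Fin N)) 1, ENNReal.ofReal (u x ^ q) ≤ K := by
  have hN' : (2 : ℝ) ≤ N := by exact_mod_cast hN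
  have hN1 : (0 : ℝ) < N - 1 := by linarith
  set p : ℝ := (N : ℝ) / (N - 1) with hp
  have hp0 : 0 < p := div_pos (by linarith) hN1
  have hp2 : p ≤ 2 := by rw [hp, div_le_iff₀ hN1]; linarith
  have hp1 : 1 < p := by linarith
  obtain ⟨q2, hqq2, hq2p⟩ := exists_between hq2
  set s : ℝ := q2 / p with hs
  have hs0 : 0 < s := div_pos (by linarith) hp0
  have hs1 : s < 1 := by rw [hs, div_lt_one hp0]; exact hq2p
  set b : ℝ := (q2 - q) / (2 * q) with hb
  have hb0 : 0 < b := div_pos (by linarith) (by linarith)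
  have hb1 : b < 1 := by rw [hb, div_lt_one (by linarith)]; linarith
  set κ : ℝ := b / p with hκ
  have hκ0 : 0 < κ := div_pos hb0 hp0
  have hκ1 : κ < 1 := by rw [hκ, div_lt_one hp0]; linarith
  set δ : ℝ := κ / (2 * κ + N) with hδ
  have hδ0 : 0 < δ := by positivity
  have hδ1 : δ < 1 := by rw [hδ, div_lt_one (by positivity)]; linarith
  set ρ : ℝ := Real.sqrt (1 - δ) with hρ
  have hρ0 : 0 < ρ := Real.sqrt_pos.2 (by linarith)
  have hρsq : ρ ^ 2 = 1 - δ := Real.sq_sqrt (by linarith)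
  have hρ1 : ρ < 1 := by nlinarith
  set c : ℝ := (1 - s) / s with hc
  have hc0 : 0 < c := div_pos (by linarith) hs0
  obtain ⟨A, hA, HA⟩ := energy (N := N) hκ0 hκ1 hc0 hρ0 hρ1 (by rw [hρsq]; linarith)
  obtain ⟨M, hM, HM⟩ := sobolev hN
  set vol : ℝ := (volume : Measure (EuclideanSpace ℝ (Fin N))).real (Metric.closedBall 0 ρ) with hvol
  set J : ENNReal := ∫⁻ x in Metric.ball (0 : EuclideanSpace ℝ (Fin N)) 1,
      ENNReal.ofReal ((1 - ‖x‖ ^ 2) ^ (-(1 / 2) : ℝ)) with hJ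
  have hJt : J ≠ ⊤ := weight_fin hN
  set B : ENNReal := (4 : ENNReal) ^ p * (M * ENNReal.ofReal (A * (vol + 1))) ^ p with hB
  refine ⟨ρ, hρ0, hρ1, J + B, ?_, ?_⟩
  · refine ENNReal.add_ne_top.2 ⟨hJt, ENNReal.mul_ne_top ?_ ?_⟩
    · exact ENNReal.rpow_ne_top_of_nonneg hp0.le (by norm_num)
    · exact ENNReal.rpow_ne_top_of_nonneg hp0.le (ENNReal.mul_ne_top hM ENNReal.ofReal_ne_top)
  intro u hu hupos hus huint
  have hKb : Metric.closedBall (0 : EuclideanSpace ℝ (Fin N)) ρ ⊆ Metric.ball 0 1 :=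
    Metric.closedBall_subset_ball hρ1
  obtain ⟨hV, hVs⟩ := power_superharmonic hu hupos hus hs0 hs1
  have hint1 : IntegrableOn u (Metric.closedBall (0 : EuclideanSpace ℝ (Fin N)) ρ) :=
    (hu.continuousOn.mono hKb).integrableOn_compact (isCompact_closedBall _ _)
  have hint2 : IntegrableOn (fun x => u x ^ s) (Metric.closedBall (0 : EuclideanSpace ℝ (Fin N)) ρ) :=
    (hV.continuousOn.mono hKb).integrableOn_compact (isCompact_closedBall _ _)
  have hint3 : IntegrableOn (fun _ => (1 : ℝ))
      (Metric.closedBall (0 : EuclideanSpace ℝ (Fin N)) ρ) :=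
    continuousOn_const.integrableOn_compact (isCompact_closedBall _ _)
  have hVint : ∫ x in Metric.closedBall (0 : EuclideanSpace ℝ (Fin N)) ρ, u x ^ s ≤ vol + 1 := by
    calc ∫ x in Metric.closedBall (0 : EuclideanSpace ℝ (Fin N)) ρ, u x ^ s
        ≤ ∫ x in Metric.closedBall (0 : EuclideanSpace ℝ (Fin N)) ρ, (1 + u x) := by
          refine setIntegral_mono_on hint2 (hint3.add hint1) measurableSet_closedBall ?_
          intro x hx
          have h0 := hupos x (hKb hx)
          rcases le_total (u x) 1 with h | h
          · have := Real.rpow_le_one h0.le h hs0.le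
            linarith
          · have := Real.rpow_le_rpow_of_exponent_le h hs1.le
            rw [Real.rpow_one] at this
            linarith
      _ = vol + ∫ x in Metric.closedBall (0 : EuclideanSpace ℝ (Fin N)) ρ, u x := by
          rw [integral_add hint3 hint1]; simp [hvol]
      _ ≤ vol + 1 := by linarith
  have key : ∀ r : ℝ, 0 ≤ r → r < 1 →
      ∫⁻ x in Metric.ball (0 : EuclideanSpace ℝ (Fin N)) r, ENNReal.ofReal (u x ^ q) ≤ J + B := by
    intro r hr0 hr1
    have hsub : Metric.ball (0 : EuclideanSpace ℝ (Fin N)) r ⊆ Metric.ball 0 1 :=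
      Metric.ball_subset_ball hr1.le
    have hdr : 0 < 1 - r ^ 2 := by nlinarith
    set γ : ℝ := (1 + κ) / 3 with hγ
    have hγ0 : 0 < γ := by rw [hγ]; linarith
    set ε : ℝ := (1 - r ^ 2) ^ γ / 2 with hε
    have hε0 : 0 < ε := by have := Real.rpow_pos_of_pos hdr γ; positivity
    have hε1 : ε < 1 := by
      have := Real.rpow_le_one hdr.le (by nlinarith) hγ0.le
      rw [hε]; linarith
    obtain ⟨W, hW, hWs, hWe, hWi⟩ := HA (fun x => u x ^ s) hV
      (fun x hx => Real.rpow_pos_of_pos (hupos x hx) s) hVs ε hε0 hε1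
    have hWint : ∫ x, ‖fderiv ℝ W x‖ ≤ A * (vol + 1) :=
      hWi.trans (mul_le_mul_of_nonneg_left hVint hA.le)
    have hsob := HM W hW hWs
    have hB1 : ∫⁻ x, (4 * ‖W x‖ₑ) ^ p ≤ B := by
      have e : ∀ x, (4 * ‖W x‖ₑ) ^ p = (4 : ENNReal) ^ p * ‖W x‖ₑ ^ p := fun x =>
        ENNReal.mul_rpow_of_nonneg _ _ hp0.le
      simp_rw [e]
      rw [lintegral_const_mul' _ _ (ENNReal.rpow_ne_top_of_nonneg hp0.le (by norm_num)), hB]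
      refine mul_le_mul_right (hsob.trans ?_) _
      refine ENNReal.rpow_le_rpow ?_ hp0.le
      exact mul_le_mul_right (ENNReal.ofReal_le_ofReal hWint) _
    calc ∫⁻ x in Metric.ball (0 : EuclideanSpace ℝ (Fin N)) r, ENNReal.ofReal (u x ^ q)
        ≤ ∫⁻ x in Metric.ball (0 : EuclideanSpace ℝ (Fin N)) r,
          (ENNReal.ofReal ((1 - ‖x‖ ^ 2) ^ (-(1 / 2) : ℝ)) + (4 * ‖W x‖ₑ) ^ p) := by
          refine setLIntegral_mono' measurableSet_ball ?_
          intro x hx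
          have hx1 : ‖x‖ < r := by simpa using hx
          have hx0 := norm_nonneg x
          have hup := hupos x (hsub hx)
          have hDr : 1 - r ^ 2 ≤ 1 - ‖x‖ ^ 2 := by nlinarith
          set D : ℝ := 1 - ‖x‖ ^ 2 with hD
          have hD0 : 0 < D := by linarith
          have h1 := pointwise_split (by linarith : (0 : ℝ) < q) hqq2 hup hD0
          have hpl : D ^ κ ≤ 4 * pPsi γ ε D := by
            refine profile_lower hD0 ?_
            have := Real.rpow_le_rpow hdr.le hDr hγ0.le
            rw [hε]; linarith
          have hW1 : u x ^ s * D ^ κ ≤ 4 * W x := by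
            rw [hWe x (hsub hx)]
            have h0 : 0 ≤ u x ^ s := Real.rpow_nonneg hup.le _
            have := mul_le_mul_of_nonneg_left hpl h0
            linarith
          have hUD0 : 0 ≤ u x ^ s * D ^ κ := by positivity
          have h2 : u x ^ q2 * D ^ b = (u x ^ s * D ^ κ) ^ p := by
            rw [Real.mul_rpow (by positivity) (by positivity), ← Real.rpow_mul hup.le,
              ← Real.rpow_mul hD0.le]
            congr 2
            · rw [hs]; field_simp
            · rw [hκ]; field_simp
          refine (ENNReal.ofReal_le_ofReal h1).trans (ENNReal.ofReal_add_le.trans ?_)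
          refine add_le_add_right ?_ _
          rw [← hb, h2, ← ENNReal.ofReal_rpow_of_nonneg hUD0 hp0.le]
          refine ENNReal.rpow_le_rpow ?_ hp0.le
          refine (ENNReal.ofReal_le_ofReal hW1).trans ?_
          rw [ENNReal.ofReal_mul (by norm_num)]
          refine mul_le_mul' (by simp) ?_
          rw [← ofReal_norm]
          exact ENNReal.ofReal_le_ofReal (le_abs_self _)
      _ = (∫⁻ x in Metric.ball (0 : EuclideanSpace ℝ (Fin N)) r,
          ENNReal.ofReal ((1 - ‖x‖ ^ 2) ^ (-(1 / 2) : ℝ))) +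
          ∫⁻ x in Metric.ball (0 : EuclideanSpace ℝ (Fin N)) r, (4 * ‖W x‖ₑ) ^ p := by
          refine lintegral_add_left ?_ _
          fun_prop
      _ ≤ J + B := by
          refine add_le_add (lintegral_mono_set hsub) ?_
          exact (setLIntegral_le_lintegral _ _).trans hB1
  have hun : Metric.ball (0 : EuclideanSpace ℝ (Fin N)) 1 =
      ⋃ n : ℕ, Metric.ball (0 : EuclideanSpace ℝ (Fin N)) (1 - 1 / ((n : ℝ) + 1)) := by
    ext x
    simp only [Metric.mem_ball, dist_zero_right, mem_iUnion]
    constructor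
    · intro hx
      obtain ⟨n, hn⟩ := exists_nat_one_div_lt (sub_pos.2 hx)
      exact ⟨n, by linarith⟩
    · rintro ⟨n, hn⟩
      have : 0 < 1 / ((n : ℝ) + 1) := by positivity
      linarith
  rw [hun, setLIntegral_iUnion_of_directed]
  · refine iSup_le fun n => key _ ?_ ?_
    · have : 1 / ((n : ℝ) + 1) ≤ 1 := by
        rw [div_le_one (by positivity)]; linarith [(Nat.cast_nonneg n : (0 : ℝ) ≤ n)]
      linarith
    · have : 0 < 1 / ((n : ℝ) + 1) := by positivity
      linarith
  · refine directed_of_isDirected_le ?_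
    intro m n hmn
    refine Metric.ball_subset_ball ?_
    have := one_div_le_one_div_of_le (by positivity : (0 : ℝ) < (m : ℝ) + 1)
      (by have : (m : ℝ) ≤ n := by exact_mod_cast hmn
          linarith : (m : ℝ) + 1 ≤ n + 1)
    linarith

lemma laplacian_affine {N : ℕ} (u : EuclideanSpace ℝ (Fin N) → ℝ) (t L : ℝ)
    (x : EuclideanSpace ℝ (Fin N)) :
    laplacian (fun y => L * (u y + t)) x = L * laplacian u x := by
  unfold laplacian
  rw [Finset.mul_sum]
  refine Finset.sum_congr rfl fun i _ => ?_
  have h : (fun y => fderiv ℝ (fun y => L * (u y + t)) y (EuclideanSpace.single i (1 : ℝ))) =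
      fun y => L * fderiv ℝ u y (EuclideanSpace.single i (1 : ℝ)) := by
    funext y
    have : fderiv ℝ (fun y => L * (u y + t)) y = L • fderiv ℝ u y := by
      have h1 : (fun y => L * (u y + t)) = L • (fun y => u y + t) := rfl
      rw [h1, fderiv_const_smul_field, Pi.smul_apply, fderiv_add_const]
    rw [this]; simp
  rw [h]
  have h1 : (fun y => L * fderiv ℝ u y (EuclideanSpace.single i (1 : ℝ))) =
    L • (fun y => fderiv ℝ u y (EuclideanSpace.single i (1 : ℝ))) := rfl
  rw [h1, fderiv_const_smul_field]; simp

theorem stmt_3 {N : ℕ} (hN : 2 ≤ N) (q : ℝ) (hq1 : 1 ≤ q) (hq2 : q < N / (N - 1)) :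
    ∃ C > (0 : ℝ), ∀ u : EuclideanSpace ℝ (Fin N) → ℝ,
      ContDiffOn ℝ 2 u (Metric.ball (0 : EuclideanSpace ℝ (Fin N)) 1) →
      (∀ x ∈ Metric.ball (0 : EuclideanSpace ℝ (Fin N)) 1, 0 ≤ u x) →
      (∀ x ∈ Metric.ball (0 : EuclideanSpace ℝ (Fin N)) 1, laplacian u x ≤ 0) →
      ∀ x ∈ Metric.ball (0 : EuclideanSpace ℝ (Fin N)) 1,
        C * (∫ t in Metric.ball (0 : EuclideanSpace ℝ (Fin N)) 1, u t ^ q) ^ (1 / q) *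
            (1 - ‖x‖) ≤ u x := by
  have hq0 : 0 < q := by linarith
  obtain ⟨ρ, hρ0, hρ1, K, hK, HK⟩ := core hN q hq1 hq2
  obtain ⟨c, hc, Hc⟩ := lower_bound hN hρ0 hρ1
  set k : ℝ := K.toReal + 1 with hk
  have hk0 : 0 < k := by positivity
  have hKk : K ≤ ENNReal.ofReal k := by
    rw [← ENNReal.ofReal_toReal hK]; exact ENNReal.ofReal_le_ofReal (by linarith)
  have hkq : 0 < k ^ (1 / q) := Real.rpow_pos_of_pos hk0 _
  refine ⟨c / k ^ (1 / q), by positivity, ?_⟩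
  intro u hu hu0 hus x hx
  have hKb : Metric.closedBall (0 : EuclideanSpace ℝ (Fin N)) ρ ⊆ Metric.ball 0 1 :=
    Metric.closedBall_subset_ball hρ1
  have hx1 : ‖x‖ < 1 := by simpa using hx
  set S : ℝ := ∫ y in Metric.closedBall (0 : EuclideanSpace ℝ (Fin N)) ρ, u y with hS
  have hS0 : 0 ≤ S := setIntegral_nonneg measurableSet_closedBall fun y hy => hu0 y (hKb hy)
  set I : ℝ := ∫ t in Metric.ball (0 : EuclideanSpace ℝ (Fin N)) 1, u t ^ q with hI
  have hI0 : 0 ≤ I := setIntegral_nonneg measurableSet_ball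
    fun y hy => Real.rpow_nonneg (hu0 y hy) _
  set vol : ℝ := (volume : Measure (EuclideanSpace ℝ (Fin N))).real (Metric.closedBall 0 ρ) with hvol
  have hvol0 : 0 ≤ vol := measureReal_nonneg
  have hint1 : IntegrableOn u (Metric.closedBall (0 : EuclideanSpace ℝ (Fin N)) ρ) :=
    (hu.continuousOn.mono hKb).integrableOn_compact (isCompact_closedBall _ _)
  have hint3 : ∀ τ : ℝ, IntegrableOn (fun _ => τ)
      (Metric.closedBall (0 : EuclideanSpace ℝ (Fin N)) ρ) := fun τ =>
    continuousOn_const.integrableOn_compact (isCompact_closedBall _ _)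
  have hL : ∀ L : ℝ, S < L → I ≤ L ^ q * k := by
    intro L hSL
    have hL0 : 0 < L := by linarith
    set τ : ℝ := (L - S) / (vol + 1) with hτ
    have hτ0 : 0 < τ := div_pos (by linarith) (by linarith)
    have hτv : τ * vol ≤ L - S := by
      rw [hτ, div_mul_eq_mul_div, div_le_iff₀ (by linarith)]
      nlinarith
    have hmain := HK (fun y => L⁻¹ * (u y + τ))
      (contDiffOn_const.mul (hu.add contDiffOn_const))
      (fun y hy => mul_pos (inv_pos.2 hL0) (by linarith [hu0 y hy]))
      (fun y hy => by
        rw [laplacian_affine]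
        exact mul_nonpos_of_nonneg_of_nonpos (inv_pos.2 hL0).le (hus y hy))
      (by
        rw [integral_const_mul, integral_add hint1 (hint3 τ)]
        rw [inv_mul_le_iff₀ hL0]
        simp only [setIntegral_const, smul_eq_mul]
        rw [← hS, ← hvol]; linarith)
    have h1 : ENNReal.ofReal I ≤ ENNReal.ofReal (L ^ q) * ENNReal.ofReal k := by
      calc ENNReal.ofReal I ≤ ∫⁻ t in Metric.ball (0 : EuclideanSpace ℝ (Fin N)) 1,
            ENNReal.ofReal (u t ^ q) := by
            by_cases hi : IntegrableOn (fun t => u t ^ q)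
                (Metric.ball (0 : EuclideanSpace ℝ (Fin N)) 1)
            · rw [hI, ofReal_integral_eq_lintegral_ofReal hi]
              filter_upwards [ae_restrict_mem measurableSet_ball] with y hy
              exact Real.rpow_nonneg (hu0 y hy) _
            · rw [hI, integral_undef hi]; simp
        _ ≤ ∫⁻ t in Metric.ball (0 : EuclideanSpace ℝ (Fin N)) 1,
            ENNReal.ofReal (L ^ q) * ENNReal.ofReal ((L⁻¹ * (u t + τ)) ^ q) := by
            refine setLIntegral_mono' measurableSet_ball ?_
            intro y hy
            have h0 := hu0 y hy
            rw [← ENNReal.ofReal_mul (Real.rpow_nonneg hL0.le _),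
              ← Real.mul_rpow hL0.le (mul_nonneg (inv_pos.2 hL0).le (by linarith)),
              mul_inv_cancel_left₀ hL0.ne']
            exact ENNReal.ofReal_le_ofReal (Real.rpow_le_rpow h0 (by linarith) hq0.le)
        _ ≤ ENNReal.ofReal (L ^ q) * ENNReal.ofReal k := by
            rw [lintegral_const_mul' _ _ ENNReal.ofReal_ne_top]
            exact mul_le_mul_right (hmain.trans hKk) _
    rw [← ENNReal.ofReal_mul (Real.rpow_nonneg hL0.le _)] at h1
    exact (ENNReal.ofReal_le_ofReal_iff (by positivity)).1 h1
  have hIS : I ^ (1 / q) ≤ S * k ^ (1 / q) := by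
    have : ∀ L : ℝ, S < L → I ^ (1 / q) ≤ L * k ^ (1 / q) := by
      intro L hSL
      have hL0 : 0 < L := by linarith
      have h := Real.rpow_le_rpow hI0 (hL L hSL) (by positivity : 0 ≤ 1 / q)
      rwa [Real.mul_rpow (by positivity) hk0.le, ← Real.rpow_mul hL0.le,
        mul_one_div_cancel hq0.ne', Real.rpow_one] at h
    have h2 : I ^ (1 / q) / k ^ (1 / q) ≤ S := by
      refine le_of_forall_gt_imp_ge_of_dense fun L hSL => ?_
      rw [div_le_iff₀ hkq]
      exact this L hSL
    rwa [div_le_iff₀ hkq] at h2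
  refine le_trans ?_ (Hc u hu hu0 hus x hx)
  refine mul_le_mul_of_nonneg_right ?_ (by linarith)
  rw [div_mul_eq_mul_div, div_le_iff₀ hkq, mul_assoc]
  exact mul_le_mul_of_nonneg_left hIS hc.le
end

section
/- Let U be a bounded open convex subset of ℝ^N with U nonempty. Then there exists a constant c > 0 such that for every x ∈ U and every r ∈ (0,1], the Lebesgue measure of B_r(x) ∩ U is at least c·r^N, where B_r(x) is the open Euclidean ball of radius r centered at x. -/
open MeasureTheory

theorem stmt_9 {N : ℕ} (hN : 1 ≤ N)
    (U : Set (EuclideanSpace ℝ (Fin N))) (hUopen : IsOpen U)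
    (hUb : Bornology.IsBounded U) (hUconv : Convex ℝ U) (hUne : U.Nonempty) :
    ∃ c > (0 : ℝ), ∀ x ∈ U, ∀ r : ℝ, r ∈ Set.Ioc (0 : ℝ) 1 →
      ENNReal.ofReal (c * r ^ N) ≤ volume (Metric.ball x r ∩ U) := by
  have hpos : 0 < volume U := hUopen.measure_pos volume hUne
  have hfin : volume U ≠ ⊤ := hUb.measure_lt_top.ne
  have hdiam : 0 ≤ Metric.diam U := Metric.diam_nonneg
  obtain ⟨D, hD⟩ : ∃ D : ℝ, D = Metric.diam U + 1 := ⟨_, rfl⟩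
  have hD0 : 0 < D := by linarith
  have hv : 0 < (volume U).toReal := ENNReal.toReal_pos hpos.ne' hfin
  refine ⟨(volume U).toReal / D ^ N, by positivity, ?_⟩
  rintro x hx r ⟨hr0, hr1⟩
  have ht0 : 0 < r / D := by positivity
  have ht1 : r / D ≤ 1 := by rw [div_le_one hD0]; linarith
  have hsub : AffineMap.homothety x (r / D) '' U ⊆ Metric.ball x r ∩ U := by
    rintro _ ⟨y, hy, rfl⟩
    constructor
    · rw [Metric.mem_ball, dist_homothety_center, Real.norm_of_nonneg ht0.le]
      have h1 : dist x y < D := by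
        have := Metric.dist_le_diam_of_mem hUb hx hy
        linarith
      calc r / D * dist x y < r / D * D := by gcongr
        _ = r := by field_simp
    · rw [AffineMap.homothety_eq_lineMap]
      exact hUconv.lineMap_mem hx hy ⟨ht0.le, ht1⟩
  refine le_trans (le_of_eq ?_) (measure_mono hsub)
  rw [Measure.addHaar_image_homothety, finrank_euclideanSpace_fin, abs_of_pos (by positivity)]
  conv_rhs => rw [← ENNReal.ofReal_toReal hfin]
  rw [← ENNReal.ofReal_mul (by positivity)]
  congr 1
  rw [div_pow]; ring
end
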